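/- arXiv:2407.06353 — 5 statements merged into one kernel-verified Lean document; each statement's English description precedes it below -/
import Mathlib

section
/- Let S be an associative ring with identity, let T be a left S-module, and let R = End_S(T) be its endomorphism ring, so that T is an (S,R)-bimodule. If R is a left max ring and left Kasch, then T is tensorly faithful as a right R-module: T ⊗_R M ≠ 0 for every nonzero left R-module M. -/
/-!
Common definitions for formalizing the Wakamatsu tilting conjecture paper.
All rings are associative with identity; right `R`-modules are treated as
left `Rᵐᵒᵖ`-modules.
-/

open CategoryTheory

universe u

/-- Vanishing of `Ext^n_S(X, Y)` for left `S`-modules. -/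
abbrev ExtVanish (S : Type u) [Ring S] (n : ℕ) (X Y : ModuleCat.{u} S) : Prop :=
  Subsingleton (((Ext ℤ (ModuleCat.{u} S) n).obj (Opposite.op X)).obj Y)

/-- `N ∈ add_S T`: `N` is a direct summand of a finite direct sum of copies of `T`. -/
def MemAdd (S : Type u) [Ring S] (T N : ModuleCat.{u} S) : Prop :=
  ∃ (k : ℕ) (M : ModuleCat.{u} S), Nonempty ((↥N × ↥M) ≃ₗ[S] (Fin k → ↥T))

/-- `N ∈ gen*_S(T)`: there is an exact sequence `⋯ → X_1 → X_0 → N → 0` with all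
`X_i ∈ add_S T` and `Ext^1_S(T, Ker f_i) = 0` for all `i ≥ 0`. -/
def MemGenStar (S : Type u) [Ring S] (T N : ModuleCat.{u} S) : Prop :=
  ∃ (X : ℕ → ModuleCat.{u} S) (f : ∀ i, ↥(X (i + 1)) →ₗ[S] ↥(X i)) (f0 : ↥(X 0) →ₗ[S] ↥N),
    (∀ i, MemAdd S T (X i)) ∧
    Function.Surjective f0 ∧
    Function.Exact (f 0) f0 ∧
    (∀ i, Function.Exact (f (i + 1)) (f i)) ∧
    ExtVanish S 1 T (ModuleCat.of S (LinearMap.ker f0)) ∧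
    (∀ i, ExtVanish S 1 T (ModuleCat.of S (LinearMap.ker (f i))))

/-- The projective dimension of the left `S`-module `M` is at most `n`: there is a projective
resolution `0 → P_n → ⋯ → P_0 → M → 0`. -/
def PdLE (S : Type u) [Ring S] (M : ModuleCat.{u} S) (n : ℕ) : Prop :=
  ∃ (P : ℕ → ModuleCat.{u} S) (d : ∀ i, ↥(P (i + 1)) →ₗ[S] ↥(P i)) (ε : ↥(P 0) →ₗ[S] ↥M),
    (∀ i, Module.Projective S ↥(P i)) ∧
    Function.Surjective ε ∧
    Function.Exact (d 0) ε ∧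
    (∀ i, Function.Exact (d (i + 1)) (d i)) ∧
    (∀ i, n < i → Subsingleton ↥(P i))

/-- The projective dimension of `M` equals `n`. -/
def PdEq (S : Type u) [Ring S] (M : ModuleCat.{u} S) (n : ℕ) : Prop :=
  PdLE S M n ∧ ∀ m, PdLE S M m → n ≤ m

/-- `N ∈ T^⊥`: `Ext^i_S(T, N) = 0` for all `i ≥ 1`. -/
def MemPerp (S : Type u) [Ring S] (T N : ModuleCat.{u} S) : Prop :=
  ∀ i, 1 ≤ i → ExtVanish S i T N

/-- `N ∈ X_T = T^⊥ ∩ gen*_S(T)`. -/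
def MemXT (S : Type u) [Ring S] (T N : ModuleCat.{u} S) : Prop :=
  MemPerp S T N ∧ MemGenStar S T N

/-- There is an exact sequence `0 → B → X_0 → ⋯ → X_n → 0` with all `X_i ∈ add_S T`. -/
def HasFiniteAddCoresolution (S : Type u) [Ring S] (T B : ModuleCat.{u} S) (n : ℕ) : Prop :=
  ∃ (X : ℕ → ModuleCat.{u} S) (g : ∀ i, ↥(X i) →ₗ[S] ↥(X (i + 1))) (g0 : ↥B →ₗ[S] ↥(X 0)),
    (∀ i, i ≤ n → MemAdd S T (X i)) ∧
    (∀ i, n < i → Subsingleton ↥(X i)) ∧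
    Function.Injective g0 ∧
    Function.Exact g0 (g 0) ∧
    (∀ i, Function.Exact (g i) (g (i + 1)))

/-- `T` is an `n`-tilting left `A`-module (Miyashita); applying this with `A = Rᵐᵒᵖ`
gives the notion for right `R`-modules. -/
def IsNTilting (A : Type u) [Ring A] (T : ModuleCat.{u} A) (n : ℕ) : Prop :=
  MemGenStar A (ModuleCat.of A A) T ∧
  PdLE A T n ∧
  (∀ i, 0 < i → ExtVanish A i T T) ∧
  HasFiniteAddCoresolution A T (ModuleCat.of A A) n

/-- `T` is a Wakamatsu tilting left `A`-module (Definition 2.2); applying this with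
`A = Rᵐᵒᵖ` gives the notion for right `R`-modules: `T ∈ gen*(A)`, `Ext^i_A(T,T) = 0` for
`i > 0`, and there is an exact sequence `0 → A → X_0 → X_1 → ⋯` with `X_i ∈ add T`
which stays exact after applying `Hom_A(-, T)`. -/
def IsWakamatsuTilting (A : Type u) [Ring A] (T : ModuleCat.{u} A) : Prop :=
  MemGenStar A (ModuleCat.of A A) T ∧
  (∀ i, 0 < i → ExtVanish A i T T) ∧
  ∃ (X : ℕ → ModuleCat.{u} A) (g : ∀ i, ↥(X i) →ₗ[A] ↥(X (i + 1))) (g0 : A →ₗ[A] ↥(X 0)),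
    (∀ i, MemAdd A T (X i)) ∧
    Function.Injective g0 ∧
    Function.Exact g0 (g 0) ∧
    (∀ i, Function.Exact (g i) (g (i + 1))) ∧
    Function.Surjective (fun h : ↥(X 0) →ₗ[A] ↥T => h.comp g0) ∧
    Function.Exact (fun h : ↥(X 1) →ₗ[A] ↥T => h.comp (g 0))
      (fun h : ↥(X 0) →ₗ[A] ↥T => h.comp g0) ∧
    (∀ i, Function.Exact (fun h : ↥(X (i + 2)) →ₗ[A] ↥T => h.comp (g (i + 1)))
      (fun h : ↥(X (i + 1)) →ₗ[A] ↥T => h.comp (g i)))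

/-- The subgroup of `T ⊗_ℤ M` generated by the balancing relations `(t·r) ⊗ m - t ⊗ (r·m)`;
the quotient of `T ⊗_ℤ M` by it is the balanced tensor product `T ⊗_R M`. -/
noncomputable def TensorRel (R : Type u) [Ring R] (T : Type u) [AddCommGroup T]
    [Module Rᵐᵒᵖ T] (M : Type u) [AddCommGroup M] [Module R M] :
    AddSubgroup (TensorProduct ℤ T M) :=
  AddSubgroup.closure
    {x | ∃ (t : T) (r : R) (m : M),
      x = (MulOpposite.op r • t) ⊗ₜ[ℤ] m - t ⊗ₜ[ℤ] (r • m)}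

/-- The right `R`-module `T` is tensorly faithful: `T ⊗_R M ≠ 0` for every nonzero left
`R`-module `M` (equivalently, the balancing relations do not exhaust `T ⊗_ℤ M`). -/
def TensorlyFaithful (R : Type u) [Ring R] (T : Type u) [AddCommGroup T]
    [Module Rᵐᵒᵖ T] : Prop :=
  ∀ (M : Type u) [AddCommGroup M] [Module R M], Nontrivial M → TensorRel R T M ≠ ⊤

/-- The natural ring homomorphism `Rᵐᵒᵖ →+* End(_S T)` induced by the right `R`-action;
it being bijective says exactly that `R → End(_S T)ᵒᵖ` is an isomorphism. -/
def rightEndNat (S R : Type u) [Ring S] [Ring R] (T : Type u) [AddCommGroup T] [Module S T]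
    [Module Rᵐᵒᵖ T] [SMulCommClass S Rᵐᵒᵖ T] : Rᵐᵒᵖ →+* Module.End S T :=
  haveI := SMulCommClass.symm S Rᵐᵒᵖ T
  Module.toModuleEnd S T

/-- The bimodule `T` is Wakamatsu tilting, i.e. a semidualizing `(S,R)`-bimodule
(Lemma 2.3(iii)). -/
def IsSemidualizing (S R : Type u) [Ring S] [Ring R] (T : Type u) [AddCommGroup T]
    [Module S T] [Module Rᵐᵒᵖ T] [SMulCommClass S Rᵐᵒᵖ T] : Prop :=
  MemGenStar Rᵐᵒᵖ (ModuleCat.of Rᵐᵒᵖ Rᵐᵒᵖ) (ModuleCat.of Rᵐᵒᵖ T) ∧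
  MemGenStar S (ModuleCat.of S S) (ModuleCat.of S T) ∧
  Function.Bijective (Module.toModuleEnd Rᵐᵒᵖ T : S →+* Module.End Rᵐᵒᵖ T) ∧
  Function.Bijective (rightEndNat S R T) ∧
  (∀ i, 0 < i → ExtVanish Rᵐᵒᵖ i (ModuleCat.of Rᵐᵒᵖ T) (ModuleCat.of Rᵐᵒᵖ T)) ∧
  (∀ i, 0 < i → ExtVanish S i (ModuleCat.of S T) (ModuleCat.of S T))

/-- The left `R`-module structure on `Hom_S(T, M)` given by `(r • f) t = f (t · r)`. -/
def homModule (S R : Type u) [Ring S] [Ring R] (T : Type u) [AddCommGroup T] [Module S T]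
    [Module Rᵐᵒᵖ T] [SMulCommClass S Rᵐᵒᵖ T] (M : Type u) [AddCommGroup M] [Module S M] :
    Module R (T →ₗ[S] M) where
  smul r f :=
    { toFun := fun t => f (MulOpposite.op r • t)
      map_add' := fun t₁ t₂ => by
        show f (MulOpposite.op r • (t₁ + t₂)) = _
        rw [smul_add, map_add]
      map_smul' := fun s t => by
        show f (MulOpposite.op r • (s • t)) = s • f (MulOpposite.op r • t)
        rw [← smul_comm s (MulOpposite.op r) t, map_smul] }
  one_smul f := by
    apply LinearMap.ext; intro t
    show f ((MulOpposite.op (1 : R)) • t) = f t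
    rw [MulOpposite.op_one, one_smul]
  mul_smul r₁ r₂ f := by
    apply LinearMap.ext; intro t
    show f ((MulOpposite.op (r₁ * r₂)) • t) = f (MulOpposite.op r₂ • MulOpposite.op r₁ • t)
    rw [MulOpposite.op_mul, mul_smul]
  smul_zero r := by apply LinearMap.ext; intro t; rfl
  smul_add r f g := by apply LinearMap.ext; intro t; rfl
  add_smul r₁ r₂ f := by
    apply LinearMap.ext; intro t
    show f ((MulOpposite.op (r₁ + r₂)) • t) = f (MulOpposite.op r₁ • t) + f (MulOpposite.op r₂ • t)
    rw [MulOpposite.op_add, add_smul, map_add]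
  zero_smul f := by
    apply LinearMap.ext; intro t
    show f ((MulOpposite.op (0 : R)) • t) = 0
    rw [MulOpposite.op_zero, zero_smul, map_zero]

/-- The evaluation map `T ⊗_ℤ Hom_S(T, M) → M`, `t ⊗ h ↦ h t`. -/
noncomputable def evalMap (S : Type u) [Ring S] (T : Type u) [AddCommGroup T] [Module S T]
    (M : Type u) [AddCommGroup M] [Module S M] :
    TensorProduct ℤ T (T →ₗ[S] M) →ₗ[ℤ] M :=
  TensorProduct.lift
    (LinearMap.mk₂ ℤ (fun t h => h t)
      (fun t₁ t₂ h => by show h (t₁ + t₂) = h t₁ + h t₂; rw [map_add])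
      (fun z t h => by show h (z • t) = z • h t; rw [map_zsmul])
      (fun t h₁ h₂ => rfl)
      (fun z t h => rfl))

/-- `Tor^R_i(T, N) = 0` for all `i ≥ 1`: for every projective resolution `P_•` of the left
`R`-module `N`, the induced complex `T ⊗_R P_•` is exact in positive degrees (expressed
via the presentation of `T ⊗_R -` as a quotient of `T ⊗_ℤ -` by the balancing relations). -/
def TorVanishPos (R : Type u) [Ring R] (T : Type u) [AddCommGroup T] [Module Rᵐᵒᵖ T]
    (N : Type u) [AddCommGroup N] [Module R N] : Prop :=
  ∀ (P : ℕ → ModuleCat.{u} R) (d : ∀ i, ↥(P (i + 1)) →ₗ[R] ↥(P i)) (ε : ↥(P 0) →ₗ[R] N),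
    (∀ i, Module.Projective R ↥(P i)) → Function.Surjective ε →
    Function.Exact (d 0) ε → (∀ i, Function.Exact (d (i + 1)) (d i)) →
    ∀ (i : ℕ) (x : TensorProduct ℤ T ↥(P (i + 1))),
      TensorProduct.map (LinearMap.id : T →ₗ[ℤ] T)
          ((d i).toAddMonoidHom.toIntLinearMap) x ∈ TensorRel R T ↥(P i) →
      ∃ y : TensorProduct ℤ T ↥(P (i + 2)),
        x - TensorProduct.map (LinearMap.id : T →ₗ[ℤ] T)
          ((d (i + 1)).toAddMonoidHom.toIntLinearMap) y ∈ TensorRel R T ↥(P (i + 1))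

/-- `M` belongs to the Bass class `B_T(S)`: the evaluation map
`T ⊗_R Hom_S(T, M) → M` is an isomorphism (it is surjective, and its kernel is exactly the
subgroup of balancing relations), `Ext^i_S(T, M) = 0` and `Tor^R_i(T, Hom_S(T, M)) = 0`
for all `i ≥ 1`. -/
def MemBass (S R : Type u) [Ring S] [Ring R] (T : Type u) [AddCommGroup T] [Module S T]
    [Module Rᵐᵒᵖ T] [SMulCommClass S Rᵐᵒᵖ T] (M : Type u) [AddCommGroup M] [Module S M] :
    Prop :=
  letI := homModule S R T M
  Function.Surjective (evalMap S T M) ∧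
  (∀ x, evalMap S T M x = 0 ↔ x ∈ TensorRel R T (T →ₗ[S] M)) ∧
  (∀ i, 1 ≤ i → ExtVanish S i (ModuleCat.of S T) (ModuleCat.of S M)) ∧
  TorVanishPos R T (T →ₗ[S] M)

/-- `R` is a left max ring: every nonzero left `R`-module has a maximal (proper) submodule. -/
def IsLeftMaxRing (R : Type u) [Ring R] : Prop :=
  ∀ (M : Type u) [AddCommGroup M] [Module R M], Nontrivial M → ∃ N : Submodule R M, IsCoatom N

/-- `R` is left Kasch: every simple quotient `R/n` by a maximal left ideal embeds as a
left ideal of `R`. -/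
def IsLeftKasch (R : Type u) [Ring R] : Prop :=
  ∀ n : Submodule R R, IsCoatom n → ∃ I : Submodule R R, Nonempty ((R ⧸ n) ≃ₗ[R] ↥I)


/-- Over a left max, left Kasch ring every nonzero left module has a nonzero linear functional. -/
theorem exists_linearMap_apply_ne_zero_of_leftMax_leftKasch {R : Type u} [Ring R]
    (hmax : IsLeftMaxRing R) (hkasch : IsLeftKasch R)
    (M : Type u) [AddCommGroup M] [Module R M] [Nontrivial M] :
    ∃ (g : M →ₗ[R] R) (m : M), g m ≠ 0 := by
  obtain ⟨N, hN⟩ := hmax M inferInstance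
  have : IsSimpleModule R (M ⧸ N) := isSimpleModule_iff_isCoatom.mpr hN
  obtain ⟨n, hn, ⟨e⟩⟩ := isSimpleModule_iff_quot_maximal.mp this
  obtain ⟨I, ⟨f⟩⟩ := hkasch n hn.out
  obtain ⟨m, -, hm⟩ := SetLike.exists_of_lt hN.lt_top
  refine ⟨I.subtype ∘ₗ f.toLinearMap ∘ₗ e.toLinearMap ∘ₗ N.mkQ, m, ?_⟩
  simpa using hm

/-- If some functional `g : M → R` takes a value that does not annihilate `T`, then
`t ⊗ m ↦ t · g m` shows that `T ⊗_R M` is nonzero. -/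
theorem tensorRel_ne_top_of_op_smul_ne_zero {R : Type u} [Ring R] {T : Type u} [AddCommGroup T]
    [Module Rᵐᵒᵖ T] {M : Type u} [AddCommGroup M] [Module R M] (g : M →ₗ[R] R) {t : T} {m : M}
    (h : MulOpposite.op (g m) • t ≠ 0) : TensorRel R T M ≠ ⊤ := by
  intro htop
  let φ : TensorProduct ℤ T M →ₗ[ℤ] T := TensorProduct.lift
    (LinearMap.mk₂ ℤ (fun t m => MulOpposite.op (g m) • t)
      (fun _ _ _ => smul_add _ _ _)
      (fun z t m => smul_comm (MulOpposite.op (g m)) z t)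
      (fun t m₁ m₂ => by simp only [map_add, MulOpposite.op_add, add_smul])
      (fun z t m => by rw [map_zsmul, MulOpposite.op_smul, smul_assoc]))
  have hφ : TensorRel R T M ≤ φ.toAddMonoidHom.ker := by
    refine (AddSubgroup.closure_le _).mpr ?_
    rintro _ ⟨t, r, m, rfl⟩
    refine AddMonoidHom.mem_ker.mpr ?_
    rw [map_sub, sub_eq_zero]
    change MulOpposite.op (g m) • MulOpposite.op r • t = MulOpposite.op (g (r • m)) • t
    rw [map_smul, smul_eq_mul, MulOpposite.op_mul, mul_smul]
  exact h (hφ (htop ▸ AddSubgroup.mem_top (t ⊗ₜ[ℤ] m)))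

/-- Lemma 2.14. Let `T` be a left `S`-module whose endomorphism ring is
`R` (acting on the right, so that `T` is an `(S,R)`-bimodule and the natural map
`Rᵐᵒᵖ → End(_S T)` is bijective). If `R` is a left max ring and left Kasch, then `T` is
tensorly faithful as a right `R`-module. -/
theorem tensorly_faithful_of_leftMax_leftKasch
    (S R : Type u) [Ring S] [Ring R] (T : Type u) [AddCommGroup T] [Module S T]
    [Module Rᵐᵒᵖ T] [SMulCommClass S Rᵐᵒᵖ T]
    (hEnd : Function.Bijective (rightEndNat S R T))
    (hmax : IsLeftMaxRing R) (hkasch : IsLeftKasch R) :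
    TensorlyFaithful R T := by
  intro M _ _ _
  obtain ⟨g, m, hgm⟩ := exists_linearMap_apply_ne_zero_of_leftMax_leftKasch hmax hkasch M
  obtain ⟨t, ht⟩ : ∃ t : T, MulOpposite.op (g m) • t ≠ 0 := by
    by_contra! h
    refine hgm (MulOpposite.op_injective (hEnd.injective (LinearMap.ext fun t => ?_)))
    rw [MulOpposite.op_zero, map_zero]
    exact h t
  exact tensorRel_ne_top_of_op_smul_ne_zero g ht
end

section
/- Let R be an associative ring with identity that is a left max ring and left Kasch. Then every Wakamatsu tilting right R-module T of finite projective dimension is projective; in particular, the Wakamatsu tilting conjecture holds for R. -/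
/-!
Common definitions for formalizing the Wakamatsu tilting conjecture paper.
All rings are associative with identity; right `R`-modules are treated as
left `Rᵐᵒᵖ`-modules.
-/

open CategoryTheory

universe u

/-- The identification of the right module `R` with the regular left `Rᵐᵒᵖ`-module. -/
def unopLinearMap (R : Type u) [Ring R] : Rᵐᵒᵖ →ₗ[Rᵐᵒᵖ] R where
  toFun := MulOpposite.unop
  map_add' _ _ := rfl
  map_smul' _ _ := rfl

/-- Over a left Kasch ring, a proper submodule of a finitely generated left module is killed by
some nonzero linear functional. -/
theorem IsLeftKasch.exists_functional {R : Type u} [Ring R] (hR : IsLeftKasch R)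
    {M : Type u} [AddCommGroup M] [Module R M] [Module.Finite R M] {I : Submodule R M}
    (hI : I ≠ ⊤) : ∃ h : M →ₗ[R] R, h ≠ 0 ∧ ∀ x ∈ I, h x = 0 := by
  obtain ⟨N, hN, hIN⟩ := (eq_top_or_exists_le_coatom I).resolve_left hI
  have : IsSimpleModule R (M ⧸ N) := isSimpleModule_iff_isCoatom.mpr hN
  obtain ⟨n, hn, ⟨e⟩⟩ := isSimpleModule_iff_quot_maximal.mp this
  obtain ⟨J, ⟨e'⟩⟩ := hR n hn.out
  have hinj : Function.Injective (J.subtype ∘ₗ e'.toLinearMap ∘ₗ e.toLinearMap) :=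
    J.injective_subtype.comp (e'.injective.comp e.injective)
  have key (x : M) :
      ((J.subtype ∘ₗ e'.toLinearMap ∘ₗ e.toLinearMap) ∘ₗ N.mkQ) x = 0 ↔ x ∈ N := by
    rw [LinearMap.comp_apply, map_eq_zero_iff _ hinj, Submodule.mkQ_apply,
      Submodule.Quotient.mk_eq_zero]
  refine ⟨(J.subtype ∘ₗ e'.toLinearMap ∘ₗ e.toLinearMap) ∘ₗ N.mkQ, fun h => hN.1 ?_,
    fun x hx => (key x).mpr (hIN hx)⟩
  exact eq_top_iff.mpr fun x _ => (key x).mp (by rw [h, LinearMap.zero_apply])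

/-- Functionals with values in `R` separate the points of a projective right `R`-module. -/
theorem eq_zero_of_forall_functional {R : Type u} [Ring R] {F : Type u} [AddCommGroup F]
    [Module Rᵐᵒᵖ F] [Module.Projective Rᵐᵒᵖ F] {x : F} (hx : ∀ ψ : F →ₗ[Rᵐᵒᵖ] R, ψ x = 0) :
    x = 0 := by
  obtain ⟨s, hs⟩ := Module.projective_def.mp ‹Module.Projective Rᵐᵒᵖ F›
  have : s x = 0 := by
    ext y
    exact MulOpposite.unop_injective (hx (unopLinearMap R ∘ₗ Finsupp.lapply y ∘ₗ s))
  rw [← hs x, this, map_zero]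

/-- A finitely generated projective right module over `R` has a finite dual basis. -/
theorem exists_dual_basis (R : Type u) [Ring R] (P : Type u) [AddCommGroup P] [Module Rᵐᵒᵖ P]
    [Module.Finite Rᵐᵒᵖ P] [Module.Projective Rᵐᵒᵖ P] :
    ∃ (m : ℕ) (b : Fin m → P) (φ : Fin m → P →ₗ[Rᵐᵒᵖ] R),
      ∀ p, p = ∑ j, MulOpposite.op (φ j p) • b j := by
  obtain ⟨m, s, hs⟩ := Module.Finite.exists_fin' Rᵐᵒᵖ P
  obtain ⟨i, hi⟩ := Module.projective_lifting_property s LinearMap.id hs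
  refine ⟨m, fun j => s (Pi.single j 1), fun j => unopLinearMap R ∘ₗ LinearMap.proj j ∘ₗ i,
    fun p => ?_⟩
  conv_lhs => rw [← LinearMap.id_apply (R := Rᵐᵒᵖ) p, ← hi, LinearMap.comp_apply,
    LinearMap.pi_apply_eq_sum_univ s]
  refine Finset.sum_congr rfl fun j _ => ?_
  congr 2
  ext k
  simp [Pi.single_apply, eq_comm]

/-- Bass: over a left Kasch ring, a finitely generated projective submodule of a projective right
module is a direct summand. -/
theorem IsLeftKasch.exists_retraction {R : Type u} [Ring R] (hR : IsLeftKasch R)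
    {P F : Type u} [AddCommGroup P] [AddCommGroup F] [Module Rᵐᵒᵖ P] [Module Rᵐᵒᵖ F]
    [Module.Finite Rᵐᵒᵖ P] [Module.Projective Rᵐᵒᵖ P] [Module.Projective Rᵐᵒᵖ F]
    (f : P →ₗ[Rᵐᵒᵖ] F) (hf : Function.Injective f) : ∃ g, g ∘ₗ f = LinearMap.id := by
  obtain ⟨m, b, φ, hb⟩ := exists_dual_basis R P
  have hφ (χ : P →ₗ[Rᵐᵒᵖ] R) : χ = ∑ j, χ (b j) • φ j := by
    ext p
    conv_lhs => rw [hb p, map_sum]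
    simp
  have hfin : Module.Finite R (P →ₗ[Rᵐᵒᵖ] R) := by
    refine ⟨Submodule.fg_def.mpr ⟨Set.range φ, Set.finite_range φ, eq_top_iff.mpr fun χ _ => ?_⟩⟩
    rw [hφ χ]
    exact Submodule.sum_mem _ fun j _ => Submodule.smul_mem _ _
      (Submodule.subset_span ⟨j, rfl⟩)
  let I : Submodule R (P →ₗ[Rᵐᵒᵖ] R) :=
    { carrier := Set.range fun ψ : F →ₗ[Rᵐᵒᵖ] R => ψ ∘ₗ f
      add_mem' := by rintro _ _ ⟨ψ, rfl⟩ ⟨ψ', rfl⟩; exact ⟨ψ + ψ', rfl⟩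
      zero_mem' := ⟨0, rfl⟩
      smul_mem' := by rintro r _ ⟨ψ, rfl⟩; exact ⟨r • ψ, rfl⟩ }
  have hI : I = ⊤ := by
    by_contra hI
    obtain ⟨h, h0, hker⟩ := hR.exists_functional hI
    have hh (χ : P →ₗ[Rᵐᵒᵖ] R) : h χ = χ (∑ j, MulOpposite.op (h (φ j)) • b j) := by
      conv_lhs => rw [hφ χ, map_sum]
      simp
    have hp : ∑ j, MulOpposite.op (h (φ j)) • b j = 0 :=
      (map_eq_zero_iff f hf).mp <| eq_zero_of_forall_functional fun ψ =>
        (hh (ψ ∘ₗ f)).symm.trans (hker _ ⟨ψ, rfl⟩)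
    exact h0 (LinearMap.ext fun χ => by rw [hh, hp, map_zero, LinearMap.zero_apply])
  choose ψ hψ using fun j => (hI ▸ Submodule.mem_top : φ j ∈ I)
  refine ⟨∑ j, ((LinearMap.toSpanSingleton Rᵐᵒᵖ P (b j)) ∘ₗ
    (⟨⟨MulOpposite.op, fun _ _ => rfl⟩, fun _ _ => rfl⟩ : R →ₗ[Rᵐᵒᵖ] Rᵐᵒᵖ) ∘ₗ ψ j), ?_⟩
  ext p
  conv_rhs => rw [LinearMap.id_apply, hb p]
  simp [← hψ]

theorem MemAdd.finite_projective {S : Type u} [Ring S] {N : ModuleCat.{u} S}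
    (h : MemAdd S (ModuleCat.of S S) N) : Module.Finite S N ∧ Module.Projective S N := by
  obtain ⟨k, M, ⟨e⟩⟩ := h
  refine ⟨Module.Finite.of_surjective (LinearMap.fst S N M ∘ₗ e.symm.toLinearMap)
    (Prod.fst_surjective.comp e.symm.surjective), ?_⟩
  exact Module.Projective.of_split (M := Fin k → S) (e.toLinearMap ∘ₗ LinearMap.inl S N M)
    (LinearMap.fst S N M ∘ₗ e.symm.toLinearMap) (by ext; simp)

section Resolution

variable {S : Type u} [Ring S] {X : ℕ → ModuleCat.{u} S} (f : ∀ i, ↥(X (i + 1)) →ₗ[S] ↥(X i))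
  {M : Type u} [AddCommGroup M] [Module S M] (f0 : ↥(X 0) →ₗ[S] M)

/-- The augmentation of the truncated resolution onto the first syzygy. -/
def syzygyAugmentation (h : Function.Exact (f 0) f0) : ↥(X 1) →ₗ[S] LinearMap.ker f0 :=
  (f 0).codRestrict _ fun x => h.apply_apply_eq_zero x

theorem syzygyAugmentation_surjective (h : Function.Exact (f 0) f0) :
    Function.Surjective (syzygyAugmentation f f0 h) := by
  rintro ⟨x, hx⟩
  obtain ⟨y, rfl⟩ := (h x).mp hx
  exact ⟨y, rfl⟩

theorem exact_syzygyAugmentation (h : Function.Exact (f 0) f0) (h' : Function.Exact (f 1) (f 0)) :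
    Function.Exact (f 1) (syzygyAugmentation f f0 h) := fun x => by
  rw [← h' x, syzygyAugmentation, Subtype.ext_iff]
  rfl

end Resolution

theorem PdLE.hasProjectiveDimensionLE {S : Type u} [Ring S] {M : Type u} [AddCommGroup M]
    [Module S M] {n : ℕ} (h : PdLE S (ModuleCat.of S M) n) :
    HasProjectiveDimensionLE (ModuleCat.of S M) n := by
  induction n generalizing M with
  | zero =>
    obtain ⟨P, d, ε, hP, hε, hd0, -, hsub⟩ := h
    have := hsub 1 one_pos
    have hinj : Function.Injective ε := (injective_iff_map_eq_zero ε).mpr fun x hx => by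
      obtain ⟨y, rfl⟩ := (hd0 x).mp hx
      rw [Subsingleton.elim y 0, map_zero]
    have := hP 0
    have : Module.Projective S M :=
      Module.Projective.of_equiv (LinearEquiv.ofBijective ε ⟨hinj, hε⟩)
    exact (projective_iff_hasProjectiveDimensionLE_zero _).mp
      ((IsProjective.iff_projective M).mp this)
  | succ n ih =>
    obtain ⟨P, d, ε, hP, hε, hd0, hd, hsub⟩ := h
    have hK : PdLE S (ModuleCat.of S (LinearMap.ker ε)) n :=
      ⟨fun i => P (i + 1), fun i => d (i + 1), syzygyAugmentation d ε hd0, fun i => hP (i + 1),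
        syzygyAugmentation_surjective d ε hd0, exact_syzygyAugmentation d ε hd0 (hd 0),
        fun i => hd (i + 1), fun i hi => hsub (i + 1) (by lia)⟩
    exact ((LinearMap.shortExact_shortComplexKer hε).hasProjectiveDimensionLT_X₃_iff n
      ((IsProjective.iff_projective _).mp (hP 0))).mpr (ih hK)

/-- Over a left Kasch ring, a right module of finite projective dimension that has a resolution by
finitely generated projectives is projective. -/
theorem IsLeftKasch.projective_of_resolution {R : Type u} [Ring R] (hR : IsLeftKasch R)
    {M : Type u} [AddCommGroup M] [Module Rᵐᵒᵖ M] {n : ℕ}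
    (hM : HasProjectiveDimensionLE (ModuleCat.of Rᵐᵒᵖ M) n)
    {X : ℕ → ModuleCat.{u} Rᵐᵒᵖ} (hX : ∀ i, Module.Finite Rᵐᵒᵖ (X i))
    (hX' : ∀ i, Module.Projective Rᵐᵒᵖ (X i))
    (f : ∀ i, ↥(X (i + 1)) →ₗ[Rᵐᵒᵖ] ↥(X i)) (f0 : ↥(X 0) →ₗ[Rᵐᵒᵖ] M)
    (hf0 : Function.Surjective f0) (hf0' : Function.Exact (f 0) f0)
    (hf : ∀ i, Function.Exact (f (i + 1)) (f i)) : Module.Projective Rᵐᵒᵖ M := by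
  induction n generalizing M X with
  | zero =>
    exact (IsProjective.iff_projective M).mpr
      ((projective_iff_hasProjectiveDimensionLE_zero _).mpr hM)
  | succ n ih =>
    have hK : HasProjectiveDimensionLE (ModuleCat.of Rᵐᵒᵖ (LinearMap.ker f0)) n :=
      ((LinearMap.shortExact_shortComplexKer hf0).hasProjectiveDimensionLT_X₃_iff n
        ((IsProjective.iff_projective _).mp (hX' 0))).mp hM
    have hsurj := syzygyAugmentation_surjective f f0 hf0'
    have : Module.Projective Rᵐᵒᵖ (LinearMap.ker f0) :=
      ih hK (fun i => hX (i + 1)) (fun i => hX' (i + 1)) (fun i => f (i + 1))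
        (syzygyAugmentation f f0 hf0') hsurj (exact_syzygyAugmentation f f0 hf0' (hf 0))
        (fun i => hf (i + 1))
    have := hX 1
    have := hX' 0
    have : Module.Finite Rᵐᵒᵖ (LinearMap.ker f0) := Module.Finite.of_surjective _ hsurj
    have hinj := (LinearMap.ker f0).injective_subtype
    obtain ⟨s, hs⟩ := ((LinearMap.exact_subtype_ker_map f0).split_tfae hinj hf0).out 1 0 |>.mp
      (hR.exists_retraction _ hinj)
    exact Module.Projective.of_split s f0 hs

/-- Remark 2.15(i). If `R` is a left max ring and left Kasch, then every
Wakamatsu tilting right `R`-module of finite projective dimension is projective; in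
particular, the Wakamatsu tilting conjecture holds for `R`. -/
theorem wtc_of_leftMax_leftKasch
    (R : Type u) [Ring R] (hmax : IsLeftMaxRing R) (hkasch : IsLeftKasch R)
    (T : Type u) [AddCommGroup T] [Module Rᵐᵒᵖ T]
    (hWT : IsWakamatsuTilting Rᵐᵒᵖ (ModuleCat.of Rᵐᵒᵖ T))
    (hpd : ∃ n : ℕ, PdLE Rᵐᵒᵖ (ModuleCat.of Rᵐᵒᵖ T) n) :
    Module.Projective Rᵐᵒᵖ T := by
  obtain ⟨n, hn⟩ := hpd
  obtain ⟨X, f, f0, hX, hf0, hf0', hf, -, -⟩ := hWT.1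
  exact hkasch.projective_of_resolution hn.hasProjectiveDimensionLE
    (fun i => (hX i).finite_projective.1) (fun i => (hX i).finite_projective.2) f f0 hf0 hf0' hf
end

section
/- Let R be a left Artinian local ring (a left Artinian ring with a unique maximal left ideal). Then every Wakamatsu tilting right R-module T of finite projective dimension is projective; in particular, the Wakamatsu tilting conjecture holds for R. -/
/-!
Common definitions for formalizing the Wakamatsu tilting conjecture paper.
All rings are associative with identity; right `R`-modules are treated as
left `Rᵐᵒᵖ`-modules.
-/

open CategoryTheory

universe u

namespace Module

variable {A : Type*} [Ring A] {J : Ideal A}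

/-- A module annihilated by a left ideal outside of which every element is a unit is semisimple. -/
theorem isSemisimpleModule_of_isUnit_of_notMem (hJ : ∀ a ∉ J, IsUnit a)
    {V : Type*} [AddCommGroup V] [Module A V] (hV : ∀ a ∈ J, ∀ v : V, a • v = 0) :
    IsSemisimpleModule A V := by
  rw [← sSup_simples_eq_top_iff_isSemisimpleModule, eq_top_iff]
  intro v _
  by_cases hv : v = 0
  · exact hv ▸ zero_mem _
  suffices IsSimpleModule A (A ∙ v) from
    Submodule.mem_sSup_of_mem (show (A ∙ v) ∈ {S : Submodule A V | IsSimpleModule A S} from this)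
      (Submodule.mem_span_singleton_self v)
  rw [isSimpleModule_iff_isAtom]
  refine ⟨by simpa using hv, fun N hN ↦ ?_⟩
  by_contra hbot
  obtain ⟨w, hw, hw0⟩ := N.exists_mem_ne_zero_of_ne_bot hbot
  obtain ⟨a, rfl⟩ := Submodule.mem_span_singleton.mp (hN.le hw)
  obtain ⟨u, rfl⟩ := hJ a fun ha ↦ hw0 (hV a ha v)
  refine hN.not_ge ((Submodule.span_singleton_le_iff_mem v N).mpr ?_)
  simpa [smul_smul] using N.smul_mem (↑u⁻¹ : A) hw

/-- In a projective module, an element killed by a nonzero scalar lies in `J • ⊤`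
if every element outside of `J` is a unit. -/
theorem Projective.mem_smul_top_of_smul_eq_zero (hJ : ∀ a ∉ J, IsUnit a) {s : A} (hs : s ≠ 0)
    {P : Type*} [AddCommGroup P] [Module A P] [Projective A P] {x : P} (hx : s • x = 0) :
    x ∈ J • (⊤ : Submodule A P) := by
  obtain ⟨σ, hσ⟩ := Projective.out (R := A) (P := P)
  have hmem (p : P) : σ x p ∈ J := by
    by_contra hp
    have h0 : s * σ x p = 0 := by
      rw [← smul_eq_mul, ← Finsupp.smul_apply, ← map_smul, hx, map_zero, Finsupp.zero_apply]
    exact hs ((hJ _ hp).mul_left_eq_zero.mp h0)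
  rw [← hσ x, Finsupp.linearCombination_apply]
  exact Submodule.sum_mem _ fun p _ ↦ Submodule.smul_mem_smul (hmem p) trivial

/-- An endomorphism with image in `J • ⊤` is nilpotent if `J` is. -/
theorem End.isNilpotent_of_forall_mem_smul_top (hnil : IsNilpotent J)
    {P : Type*} [AddCommGroup P] [Module A P] (u : Module.End A P)
    (hu : ∀ x, u x ∈ J • (⊤ : Submodule A P)) : IsNilpotent u := by
  obtain ⟨k, hk⟩ := hnil
  have key (n : ℕ) (x : P) : (u ^ n) x ∈ J ^ n • (⊤ : Submodule A P) := by
    induction n with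
    | zero => simp [Submodule.pow_zero]
    | succ n ih =>
      have hle : (J ^ n • (⊤ : Submodule A P)).map u ≤ J ^ (n + 1) • ⊤ := by
        rw [Submodule.map_smul'', Submodule.pow_succ, Submodule.mul_smul]
        exact smul_mono_right _ (Submodule.map_le_iff_le_comap.mpr fun y _ ↦ hu y)
      rw [pow_succ', Module.End.mul_apply]
      exact hle (Submodule.mem_map_of_mem ih)
  refine ⟨k, LinearMap.ext fun x ↦ ?_⟩
  simpa [hk] using key k x

/-- If every element outside of the nilpotent left ideal `J` is a unit and `J` has a nonzero left
annihilator, then injective maps between projective modules split. -/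
theorem Projective.exists_leftInverse_of_injective (hJ : ∀ a ∉ J, IsUnit a) (hnil : IsNilpotent J)
    {s : A} (hs : s ≠ 0) (hsJ : ∀ a ∈ J, s * a = 0)
    {P Q : Type*} [AddCommGroup P] [Module A P] [AddCommGroup Q] [Module A Q]
    [Projective A P] [Projective A Q] (f : P →ₗ[A] Q) (hf : Function.Injective f) :
    ∃ e : Q →ₗ[A] P, e ∘ₗ f = LinearMap.id := by
  set JP : Submodule A P := J • ⊤
  set JQ : Submodule A Q := J • ⊤
  have hle : JP ≤ JQ.comap f := by
    rw [← Submodule.map_le_iff_le_comap, Submodule.map_smul'']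
    exact smul_mono_right _ le_top
  have hcomap : JQ.comap f ≤ JP := fun x hx ↦ by
    refine Projective.mem_smul_top_of_smul_eq_zero hJ hs (hf ?_)
    rw [map_smul, map_zero]
    refine Submodule.smul_induction_on (p := fun y ↦ s • y = 0) hx (fun a ha y _ ↦ ?_)
      fun y z hy hz ↦ by rw [smul_add, hy, hz, add_zero]
    rw [smul_smul, hsJ a ha, zero_smul]
  have hinj : Function.Injective (JP.mapQ JQ f hle) := by
    rw [← LinearMap.ker_eq_bot, Submodule.ker_mapQ, eq_bot_iff, Submodule.map_le_iff_le_comap]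
    simpa using hcomap
  have : IsSemisimpleModule A (Q ⧸ JQ) := by
    refine isSemisimpleModule_of_isUnit_of_notMem hJ fun a ha v ↦ ?_
    obtain ⟨y, rfl⟩ := JQ.mkQ_surjective v
    rw [← map_smul, Submodule.mkQ_apply, Submodule.Quotient.mk_eq_zero]
    exact Submodule.smul_mem_smul ha trivial
  obtain ⟨h, hh⟩ := IsSemisimpleModule.extension_property _ hinj LinearMap.id
  obtain ⟨g, hg⟩ := Module.projective_lifting_property JP.mkQ (h ∘ₗ JQ.mkQ) JP.mkQ_surjective
  have hu : IsUnit (g ∘ₗ f : Module.End A P) := by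
    rw [← sub_add_cancel (g ∘ₗ f : Module.End A P) 1]
    refine IsNilpotent.isUnit_add_one (End.isNilpotent_of_forall_mem_smul_top hnil _ fun x ↦ ?_)
    rw [← Submodule.Quotient.mk_eq_zero, ← Submodule.mkQ_apply, LinearMap.sub_apply, map_sub,
      sub_eq_zero]
    exact (LinearMap.congr_fun hg (f x)).trans (LinearMap.congr_fun hh (JP.mkQ x))
  obtain ⟨u, hu⟩ := hu
  refine ⟨(↑u⁻¹ : Module.End A P) ∘ₗ g, ?_⟩
  rw [LinearMap.comp_assoc, ← hu]
  exact u.inv_mul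

/-- The cokernel of a split injection into a projective module is projective. -/
theorem Projective.of_exact_of_leftInverse {K Q M : Type*} [AddCommGroup K] [Module A K]
    [AddCommGroup Q] [Module A Q] [AddCommGroup M] [Module A M] [Projective A Q]
    {f : K →ₗ[A] Q} {ε : Q →ₗ[A] M} (hfε : Function.Exact f ε) (hε : Function.Surjective ε)
    {e : Q →ₗ[A] K} (he : e ∘ₗ f = LinearMap.id) : Projective A M := by
  have hf : Function.Injective f :=
    Function.LeftInverse.injective (g := e) (LinearMap.congr_fun he)
  have hsplit : (∃ l, ε ∘ₗ l = LinearMap.id) ↔ ∃ l, l ∘ₗ f = LinearMap.id :=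
    (hfε.split_tfae hf hε).out 0 1
  obtain ⟨l, hl⟩ := hsplit.mpr ⟨e, he⟩
  exact Projective.of_split l ε hl

end Module

/-- If injective maps between projective modules split, then modules of finite projective dimension
are projective. -/
theorem PdLE.projective {A : Type u} [Ring A]
    (hsplit : ∀ (P Q : Type u) [AddCommGroup P] [Module A P] [AddCommGroup Q] [Module A Q]
      [Module.Projective A P] [Module.Projective A Q] (f : P →ₗ[A] Q), Function.Injective f →
      ∃ e : Q →ₗ[A] P, e ∘ₗ f = LinearMap.id)
    {n : ℕ} {M : ModuleCat.{u} A} (h : PdLE A M n) : Module.Projective A M := by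
  induction n generalizing M with
  | zero =>
    obtain ⟨P, d, ε, hP, hε, hdε, -, hsub⟩ := h
    have := hP 0
    have := hsub 1 one_pos
    have hinj : Function.Injective ε := by
      rw [injective_iff_map_eq_zero]
      intro x hx
      obtain ⟨y, rfl⟩ := (hdε x).mp hx
      rw [Subsingleton.elim y 0, map_zero]
    exact Module.Projective.of_equiv (LinearEquiv.ofBijective ε ⟨hinj, hε⟩)
  | succ n ih =>
    obtain ⟨P, d, ε, hP, hε, hdε, hd, hsub⟩ := h
    have hK : PdLE A (ModuleCat.of A (LinearMap.ker ε)) n := by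
      refine ⟨fun i ↦ P (i + 1), fun i ↦ d (i + 1),
        (d 0).codRestrict _ fun x ↦ (hdε _).mpr ⟨x, rfl⟩, fun i ↦ hP _, ?_, ?_, fun i ↦ hd _,
        fun i hi ↦ hsub _ (by lia)⟩
      · rintro ⟨x, hx⟩
        obtain ⟨y, rfl⟩ := (hdε x).mp hx
        exact ⟨y, rfl⟩
      · exact fun x ↦ Subtype.ext_iff.trans (hd 0 x)
    have : Module.Projective A (LinearMap.ker ε) := ih hK
    have := hP 0
    obtain ⟨e, he⟩ := hsplit _ _ (LinearMap.ker ε).subtype Subtype.val_injective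
    exact Module.Projective.of_exact_of_leftInverse (LinearMap.exact_subtype_ker_map ε) hε he

section Opposite

variable {R : Type*} [Ring R]

/-- A two-sided ideal of `R`, as a left ideal of the opposite ring. -/
def Ideal.toMulOpposite (I : Ideal R) [I.IsTwoSided] : Ideal Rᵐᵒᵖ where
  carrier := {a | a.unop ∈ I}
  add_mem' ha hb := I.add_mem ha hb
  zero_mem' := I.zero_mem
  smul_mem' c _ ha := I.mul_mem_right c.unop ha

theorem Ideal.toMulOpposite_pow_le (I : Ideal R) [I.IsTwoSided] (n : ℕ) :
    I.toMulOpposite ^ n ≤ (I ^ n).toMulOpposite := by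
  induction n with
  | zero => exact fun a _ ↦ by simp [Submodule.pow_zero, toMulOpposite]
  | succ n ih =>
    rw [Submodule.pow_succ, Ideal.mul_le]
    intro a ha b hb
    change b.unop * a.unop ∈ I ^ (n + 1)
    rw [Ideal.IsTwoSided.pow_succ]
    exact Ideal.mul_mem_mul hb (ih ha)

theorem Ideal.isNilpotent_toMulOpposite {I : Ideal R} [I.IsTwoSided] (hI : IsNilpotent I) :
    IsNilpotent I.toMulOpposite := by
  obtain ⟨n, hn⟩ := hI
  refine ⟨n, eq_bot_iff.mpr fun a ha ↦ ?_⟩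
  have h : a.unop ∈ I ^ n := I.toMulOpposite_pow_le n ha
  rw [hn] at h
  exact MulOpposite.unop_injective h

/-- A nilpotent two-sided ideal of a nontrivial ring has a nonzero right annihilator. -/
theorem Ideal.exists_ne_zero_forall_mul_eq_zero [Nontrivial R] {I : Ideal R} [I.IsTwoSided]
    (hI : IsNilpotent I) : ∃ s ≠ 0, ∀ a ∈ I, a * s = 0 := by
  classical
  obtain ⟨n, hn, hmin⟩ : ∃ n, I ^ (n + 1) = 0 ∧ I ^ n ≠ 0 := by
    have h0 : Nat.find hI ≠ 0 := fun h ↦ top_ne_bot (α := Ideal R)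
      (by simpa [h, Submodule.pow_zero] using Nat.find_spec hI)
    obtain ⟨n, hn⟩ := Nat.exists_eq_succ_of_ne_zero h0
    exact ⟨n, by simpa [hn] using Nat.find_spec hI, Nat.find_min hI (by lia)⟩
  obtain ⟨s, hs, hs0⟩ := Submodule.exists_mem_ne_zero_of_ne_bot hmin
  refine ⟨s, hs0, fun a ha ↦ ?_⟩
  have h : a * s ∈ I ^ (n + 1) := Ideal.IsTwoSided.pow_succ (I := I) n ▸ Ideal.mul_mem_mul ha hs
  rwa [hn] at h

/-- In a ring with a unique maximal left ideal, which is then two-sided, the elements outside of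
it are units. -/
theorem Ideal.isUnit_of_notMem_of_unique_isCoatom {m : Ideal R} [m.IsTwoSided] (hm : IsCoatom m)
    (huniq : ∀ n : Ideal R, IsCoatom n → n = m) {r : R} (hr : r ∉ m) : IsUnit r := by
  have hleft (a : R) (ha : a ∉ m) : ∃ b, b * a = 1 := by
    have htop : Ideal.span {a} = ⊤ := by
      by_contra h
      obtain ⟨n, hn, hle⟩ := (eq_top_or_exists_le_coatom (Ideal.span {a})).resolve_left h
      exact ha (huniq n hn ▸ hle (Ideal.mem_span_singleton_self a))
    exact Ideal.mem_span_singleton'.mp (htop ▸ Submodule.mem_top)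
  obtain ⟨b, hb⟩ := hleft r hr
  have hbm : b ∉ m := fun h ↦
    hm.1 (m.eq_top_iff_one.mpr (hb ▸ m.mul_mem_right r h))
  obtain ⟨c, hc⟩ := hleft b hbm
  have hcr : c = r := left_inv_eq_right_inv hc hb
  exact ⟨⟨r, b, hcr ▸ hc, hb⟩, rfl⟩

end Opposite

/-- Remark 2.15(iii), part of Corollary 1.2. If `R` is a left Artinian
local ring (unique maximal left ideal `m`), then every Wakamatsu tilting right `R`-module
of finite projective dimension is projective; in particular, the Wakamatsu tilting
conjecture holds for `R`. -/
theorem wtc_of_leftArtinian_local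
    (R : Type u) [Ring R] [IsArtinian R R]
    (m : Submodule R R) (hm : IsCoatom m) (huniq : ∀ n : Submodule R R, IsCoatom n → n = m)
    (T : Type u) [AddCommGroup T] [Module Rᵐᵒᵖ T]
    (hWT : IsWakamatsuTilting Rᵐᵒᵖ (ModuleCat.of Rᵐᵒᵖ T))
    (hpd : ∃ n : ℕ, PdLE Rᵐᵒᵖ (ModuleCat.of Rᵐᵒᵖ T) n) :
    Module.Projective Rᵐᵒᵖ T := by
  have hmJ : m = Ring.jacobson R := by
    rw [Ring.jacobson, Module.jacobson,
      show {n : Submodule R R | IsCoatom n} = {m} from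
        Set.ext fun n ↦ ⟨huniq n, fun h ↦ h ▸ hm⟩, sInf_singleton]
  obtain ⟨n, hn⟩ := hpd
  have htwo : Ideal.IsTwoSided m := hmJ ▸ inferInstance
  have hnil : IsNilpotent (m : Ideal R) := hmJ ▸ IsSemiprimaryRing.isNilpotent
  have : Nontrivial R := (Submodule.nontrivial_iff R).mp ⟨m, ⊤, hm.1⟩
  obtain ⟨s, hs, hsm⟩ := Ideal.exists_ne_zero_forall_mul_eq_zero hnil
  refine PdLE.projective (M := ModuleCat.of Rᵐᵒᵖ T) (fun P Q _ _ _ _ _ _ f hf ↦ ?_) hn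
  refine Module.Projective.exists_leftInverse_of_injective (J := Ideal.toMulOpposite m)
    (fun a ha ↦ ?_) (Ideal.isNilpotent_toMulOpposite hnil) (s := MulOpposite.op s)
    (by simpa using hs) (fun a ha ↦ MulOpposite.unop_injective (hsm _ ha)) f hf
  exact (Ideal.isUnit_of_notMem_of_unique_isCoatom hm huniq (r := a.unop) ha).op
end

section
/- Let S and R be associative rings with identity and let T be an (S,R)-bimodule. Then the following are equivalent: (i) T is a Wakamatsu tilting right R-module and the natural ring homomorphism S → End(T_R) is an isomorphism; (ii) T is a Wakamatsu tilting left S-module and the natural ring homomorphism R → End(_S T)^op is an isomorphism; (iii) T ∈ gen*(R) as a right R-module and T ∈ gen*(S) as a left S-module, the natural maps S → End(T_R) and R → End(_S T)^op are isomorphisms, and Ext^i_R(T,T) = 0 = Ext^i_S(T,T) for all i > 0. -/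
/-!
Common definitions for formalizing the Wakamatsu tilting conjecture paper.
All rings are associative with identity; right `R`-modules are treated as
left `Rᵐᵒᵖ`-modules.
-/

open CategoryTheory

universe u

/-- A long exact sequence of modules with projective terms, as a projective resolution. -/
noncomputable def resolutionOfExact {A : Type u} [Ring A] {N : ModuleCat.{u} A}
    (X : ℕ → ModuleCat.{u} A) (f : ∀ i, ↥(X (i + 1)) →ₗ[A] ↥(X i)) (f0 : ↥(X 0) →ₗ[A] ↥N)
    (hX : ∀ i, Module.Projective A ↥(X i)) (h0 : Function.Surjective f0)
    (h1 : Function.Exact (f 0) f0) (h2 : ∀ i, Function.Exact (f (i + 1)) (f i)) :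
    ProjectiveResolution N where
  complex := ChainComplex.of X (fun i => ModuleCat.ofHom (f i)) fun i => by
    ext x
    exact (h2 i).apply_apply_eq_zero x
  projective i := (IsProjective.iff_projective (X i)).1 (hX i)
  π := (ChainComplex.toSingle₀Equiv _ _).symm ⟨ModuleCat.ofHom f0, by
    refine (congrArg (· ≫ ModuleCat.ofHom f0) (ChainComplex.of_d X _ 0)).trans ?_
    ext x
    exact h1.apply_apply_eq_zero x⟩
  quasiIso := ⟨fun n => by
    cases n with
    | zero =>
      rw [ChainComplex.quasiIsoAt₀_iff, ShortComplex.quasiIso_iff_of_zeros' _ rfl rfl rfl]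
      constructor
      · rw [ShortComplex.moduleCat_exact_iff]
        intro x hx
        obtain ⟨y, hy⟩ := (h1 x).1 hx
        refine ⟨y, ?_⟩
        rw [← hy]
        exact congrArg (fun φ : X 1 ⟶ X 0 => φ.hom y)
          (ChainComplex.of_d X (fun i => ModuleCat.ofHom (f i)) 0)
      · exact (ModuleCat.epi_iff_surjective _).2 h0
    | succ n =>
      rw [quasiIsoAt_iff_exactAt' _ _ (ChainComplex.exactAt_succ_single_obj _ _),
        HomologicalComplex.exactAt_iff' _ (n + 1 + 1) (n + 1) n (by simp) (by simp),
        ShortComplex.moduleCat_exact_iff]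
      intro x hx
      obtain ⟨y, hy⟩ := (h2 n x).1 ((congrArg (fun φ : X (n + 1) ⟶ X n => φ.hom x)
        (ChainComplex.of_d X (fun i => ModuleCat.ofHom (f i)) n)).symm.trans hx)
      refine ⟨y, ?_⟩
      rw [← hy]
      exact congrArg (fun φ : X (n + 1 + 1) ⟶ X (n + 1) => φ.hom y)
        (ChainComplex.of_d X (fun i => ModuleCat.ofHom (f i)) (n + 1))⟩

theorem extVanish_iff_of_exact {A : Type u} [Ring A] {N : ModuleCat.{u} A}
    (X : ℕ → ModuleCat.{u} A) (f : ∀ i, ↥(X (i + 1)) →ₗ[A] ↥(X i)) (f0 : ↥(X 0) →ₗ[A] ↥N)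
    (hX : ∀ i, Module.Projective A ↥(X i)) (h0 : Function.Surjective f0)
    (h1 : Function.Exact (f 0) f0) (h2 : ∀ i, Function.Exact (f (i + 1)) (f i))
    (Y : ModuleCat.{u} A) (i : ℕ) :
    ExtVanish A (i + 1) N Y ↔
      Function.Exact (fun h : ↥(X i) →ₗ[A] ↥Y => h.comp (f i))
        (fun h : ↥(X (i + 1)) →ₗ[A] ↥Y => h.comp (f (i + 1))) := by
  have e := (resolutionOfExact X f f0 hX h0 h1 h2).isoExt (R := ℤ) (i + 1) Y
  rw [ExtVanish, ← ModuleCat.isZero_iff_subsingleton, e.isZero_iff,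
    ← HomologicalComplex.exactAt_iff_isZero_homology,
    HomologicalComplex.exactAt_iff' _ i (i + 1) (i + 1 + 1) (by simp) (by simp),
    ShortComplex.moduleCat_exact_iff]
  have hd (j : ℕ) : (resolutionOfExact X f f0 hX h0 h1 h2).complex.d (j + 1) j =
      ModuleCat.ofHom (f j) := ChainComplex.of_d X (fun i => ModuleCat.ofHom (f i)) j
  have hD (j : ℕ) (x : X j ⟶ Y) :
      (((resolutionOfExact X f f0 hX h0 h1 h2).complex.linearYonedaObj ℤ Y).d j (j + 1)).hom x =
        ModuleCat.ofHom (f j) ≫ x := by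
    rw [← hd]; rfl
  constructor
  · intro H h
    constructor
    · intro hh
      obtain ⟨y, hy⟩ := H (ModuleCat.ofHom h) ((hD (i + 1) _).trans 
        (ModuleCat.hom_ext hh))
      refine ⟨y.hom, ?_⟩
      have := (hD i y).symm.trans hy
      exact congrArg ModuleCat.Hom.hom this
    · rintro ⟨y, rfl⟩
      ext x
      change y (f i (f (i + 1) x)) = 0
      rw [(h2 i).apply_apply_eq_zero, map_zero]
  · intro H x hx
    have hx' : ModuleCat.ofHom (f (i + 1)) ≫ x = 0 := (hD (i + 1) x).symm.trans hx
    obtain ⟨y, hy⟩ := (H x.hom).1 (congrArg ModuleCat.Hom.hom hx')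
    refine ⟨ModuleCat.ofHom y, (hD i _).trans (ModuleCat.hom_ext hy)⟩

theorem extVanish_one_self {A : Type u} [Ring A] (Y : ModuleCat.{u} A) :
    ExtVanish A 1 (ModuleCat.of A A) Y := by
  have : Projective (ModuleCat.of A A) :=
    (IsProjective.iff_projective A).1 inferInstance
  exact ModuleCat.isZero_iff_subsingleton.1 (isZero_Ext_succ_of_projective _ _ 0)

theorem memAdd_iff {A : Type u} [Ring A] (T N : ModuleCat.{u} A) :
    MemAdd A T N ↔ ∃ (k : ℕ) (a : Fin k → ↥N →ₗ[A] ↥T) (b : Fin k → ↥T →ₗ[A] ↥N),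
      ∀ n, ∑ i, b i (a i n) = n := by
  constructor
  · rintro ⟨k, M, ⟨e⟩⟩
    refine ⟨k, fun i => LinearMap.proj i ∘ₗ e.toLinearMap ∘ₗ LinearMap.inl A N M,
      fun i => LinearMap.fst A N M ∘ₗ e.symm.toLinearMap ∘ₗ LinearMap.single A (fun _ => ↥T) i,
      fun n => ?_⟩
    simp only [LinearMap.comp_apply, ← map_sum]
    simp only [LinearMap.proj_apply, LinearEquiv.coe_coe, LinearMap.coe_single,
      Finset.univ_sum_single, LinearEquiv.symm_apply_apply, LinearMap.inl_apply,
      LinearMap.fst_apply]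
  · rintro ⟨k, a, b, h⟩
    let s : (Fin k → ↥T) →ₗ[A] ↥N := ∑ i, b i ∘ₗ LinearMap.proj i
    have hs (n : N) : s (LinearMap.pi a n) = n := by simpa [s] using h n
    have hk (y : Fin k → ↥T) : (LinearMap.id - LinearMap.pi a ∘ₗ s : (Fin k → ↥T) →ₗ[A] (Fin k → ↥T)) y ∈ LinearMap.ker s := by
      rw [LinearMap.mem_ker, LinearMap.sub_apply, map_sub, LinearMap.comp_apply, hs]
      exact sub_self _
    refine ⟨k, ModuleCat.of A (LinearMap.ker s), ⟨LinearEquiv.ofLinearMap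
      ((LinearMap.pi a).coprod (LinearMap.ker s).subtype)
      (s.prod ((LinearMap.id - LinearMap.pi a ∘ₗ s).codRestrict _ hk)) ?_ ?_⟩⟩
    · refine LinearMap.ext fun y => ?_
      change LinearMap.pi a (s y) + (y - LinearMap.pi a (s y)) = y
      abel
    · refine LinearMap.ext fun ⟨n, x, hx⟩ => ?_
      have hx : s x = 0 := hx
      have : s (LinearMap.pi a n + x) = n := by rw [map_add, hs, hx, add_zero]
      refine Prod.ext this (Subtype.ext ?_)
      change (LinearMap.pi a n + x) - LinearMap.pi a (s (LinearMap.pi a n + x)) = x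
      rw [this]
      abel

theorem MemAdd.projective {A : Type u} [Ring A] {T N : ModuleCat.{u} A}
    [Module.Projective A T] (h : MemAdd A T N) : Module.Projective A N := by
  obtain ⟨k, M, ⟨e⟩⟩ := h
  have : Module.Projective A (Fin k → ↥T) :=
    .of_equiv (DirectSum.linearEquivFunOnFintype A (Fin k) fun _ => ↥T)
  exact Module.Projective.of_split (e.toLinearMap ∘ₗ LinearMap.inl A N M)
    (LinearMap.fst A N M ∘ₗ e.symm.toLinearMap) (LinearMap.ext fun n => by simp)

section Duality

variable {A B : Type u} [Ring A] [Ring B] {T : Type u} [AddCommGroup T] [Module A T] [Module B T]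
  [SMulCommClass A B T]

theorem MemAdd.dual {M N : ModuleCat.{u} A} {L : ModuleCat.{u} B} (h : MemAdd A M N)
    (e : (↥M →ₗ[A] T) ≃ₗ[B] ↥L) : MemAdd B L (ModuleCat.of B (↥N →ₗ[A] T)) := by
  obtain ⟨k, a, b, h⟩ := (memAdd_iff _ _).1 h
  refine (memAdd_iff _ _).2 ⟨k, fun i => e.toLinearMap ∘ₗ LinearMap.lcomp B T (b i),
    fun i => LinearMap.lcomp B T (a i) ∘ₗ e.symm.toLinearMap, fun φ => ?_⟩
  refine LinearMap.ext fun n => ?_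
  simp [LinearMap.lcomp_apply, LinearMap.sum_apply, ← map_sum, h]

variable (A B T) in
/-- `M` is reflexive with respect to the bimodule `T`: the evaluation map
`M → Hom_B(Hom_A(M, T), T)` is bijective. -/
def IsReflexive (M : Type u) [AddCommGroup M] [Module A M] : Prop :=
  Function.Bijective (LinearMap.applyₗ' B : M →+ (M →ₗ[A] T) →ₗ[B] T)

theorem IsReflexive.of_memAdd {M N : ModuleCat.{u} A} (hM : IsReflexive A B T M)
    (h : MemAdd A M N) : IsReflexive A B T N := by
  obtain ⟨k, a, b, h⟩ := (memAdd_iff _ _).1 h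
  constructor
  · refine (injective_iff_map_eq_zero _).2 fun n hn => ?_
    have ha (i : Fin k) : a i n = 0 := by
      refine (injective_iff_map_eq_zero _).1 hM.1 _ (LinearMap.ext fun φ => ?_)
      exact LinearMap.congr_fun hn (φ ∘ₗ a i)
    rw [← h n]
    simp [ha]
  · intro φ
    choose m hm using fun i => hM.2 (φ ∘ₗ LinearMap.lcomp B T (a i))
    refine ⟨∑ i, b i (m i), LinearMap.ext fun ψ => ?_⟩
    have hψ : ψ = ∑ i, LinearMap.lcomp B T (a i) (ψ ∘ₗ b i) := by
      refine LinearMap.ext fun n => ?_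
      simp [LinearMap.sum_apply, LinearMap.lcomp_apply, ← map_sum, h]
    conv_rhs => rw [hψ, map_sum]
    change ψ _ = _
    rw [map_sum]
    exact Finset.sum_congr rfl fun i _ => LinearMap.congr_fun (hm i) (ψ ∘ₗ b i)

theorem isReflexive_self
    (h : Function.Bijective (Module.toModuleEnd B T : A →+* Module.End B T)) :
    IsReflexive A B T A := by
  constructor
  · refine (injective_iff_map_eq_zero _).2 fun a ha => ?_
    refine (injective_iff_map_eq_zero _).1 h.1 _ (LinearMap.ext fun t => ?_)
    exact LinearMap.congr_fun ha (LinearMap.toSpanSingleton A T t)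
  · intro φ
    let e : T →ₗ[B] (A →ₗ[A] T) :=
      { toFun t := LinearMap.toSpanSingleton A T t
        map_add' t t' := by ext; simp
        map_smul' b t := by ext; simp }
    obtain ⟨a, ha⟩ := h.2 (φ ∘ₗ e)
    refine ⟨a, LinearMap.ext fun ψ => ?_⟩
    have hψ : e (ψ 1) = ψ := by ext; simp [e]
    have h1 := LinearMap.congr_fun ha (ψ 1)
    rw [LinearMap.comp_apply, hψ] at h1
    rw [← h1]
    change ψ a = a • ψ 1
    rw [← map_smul, smul_eq_mul, mul_one]

theorem exact_bidual {M₁ M₂ M₃ : Type u} [AddCommGroup M₁] [AddCommGroup M₂] [AddCommGroup M₃]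
    [Module A M₁] [Module A M₂] [Module A M₃] (h₁ : IsReflexive A B T M₁)
    (h₂ : IsReflexive A B T M₂) (h₃ : IsReflexive A B T M₃) {f : M₁ →ₗ[A] M₂} {g : M₂ →ₗ[A] M₃}
    (H : Function.Exact f g) :
    Function.Exact (fun φ : (M₁ →ₗ[A] T) →ₗ[B] T => φ.comp (LinearMap.lcomp B T f))
      (fun φ : (M₂ →ₗ[A] T) →ₗ[B] T => φ.comp (LinearMap.lcomp B T g)) := by
  intro φ
  obtain ⟨x, rfl⟩ := h₂.2 φ
  constructor
  · intro hφ
    obtain ⟨y, rfl⟩ := (H x).1 ((injective_iff_map_eq_zero _).1 h₃.1 _ hφ)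
    exact ⟨LinearMap.applyₗ' B y, rfl⟩
  · rintro ⟨ψ, hψ⟩
    obtain ⟨y, rfl⟩ := h₁.2 ψ
    have : f y = x := h₂.1 hψ
    subst this
    refine LinearMap.ext fun θ => ?_
    change θ (g (f y)) = 0
    rw [H.apply_apply_eq_zero, map_zero]

variable [SMulCommClass B A T]

theorem isReflexive_module
    (h : Function.Bijective (Module.toModuleEnd A T : B →+* Module.End A T)) :
    IsReflexive A B T T := by
  constructor
  · refine (injective_iff_map_eq_zero _).2 fun t ht => ?_
    exact LinearMap.congr_fun ht LinearMap.id
  · intro φ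
    refine ⟨φ LinearMap.id, LinearMap.ext fun ψ => ?_⟩
    obtain ⟨b, rfl⟩ := h.2 ψ
    change b • φ LinearMap.id = _
    rw [← map_smul]
    rfl

theorem IsWakamatsuTilting.dual (hT : IsWakamatsuTilting B (ModuleCat.of B T))
    (hA : Function.Bijective (Module.toModuleEnd B T : A →+* Module.End B T)) :
    MemGenStar A (ModuleCat.of A A) (ModuleCat.of A T) ∧
      Function.Bijective (Module.toModuleEnd A T : B →+* Module.End A T) ∧
      ∀ i, 0 < i → ExtVanish A i (ModuleCat.of A T) (ModuleCat.of A T) := by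
  obtain ⟨-, -, X, g, g0, hX, hg0, hg1, hg2, hd0, hd1, hd2⟩ := hT
  have hrefl (i : ℕ) : IsReflexive B A T (X i) :=
    (isReflexive_module hA).of_memAdd (M := ModuleCat.of B T) (hX i)
  let P (i : ℕ) : ModuleCat.{u} A := ModuleCat.of A (↥(X i) →ₗ[B] T)
  let f (i : ℕ) : ↥(P (i + 1)) →ₗ[A] ↥(P i) := LinearMap.lcomp A T (g i)
  let f0 : ↥(P 0) →ₗ[A] T :=
    { toFun h := h (g0 1)
      map_add' _ _ := rfl
      map_smul' _ _ := rfl }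
  have hf0 (h : ↥(X 0) →ₗ[B] T) (b : B) : h (g0 b) = b • h (g0 1) := by
    rw [← map_smul, ← map_smul, smul_eq_mul, mul_one]
  let α : A →ₗ[A] (T →ₗ[B] T) :=
    { toFun a := (Module.toModuleEnd B T : A →+* Module.End B T) a
      map_add' := map_add (Module.toModuleEnd B T : A →+* Module.End B T)
      map_smul' a a' := map_mul (Module.toModuleEnd B T : A →+* Module.End B T) a a' }
  let e : (T →ₗ[B] T) ≃ₗ[A] A := (LinearEquiv.ofBijective α hA).symm
  have hP (i : ℕ) : MemAdd A (ModuleCat.of A A) (P i) :=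
    MemAdd.dual (M := ModuleCat.of B T) (L := ModuleCat.of A A) (hX i) e
  have hproj (i : ℕ) : Module.Projective A (P i) :=
    have : Module.Projective A (ModuleCat.of A A) := inferInstanceAs (Module.Projective A A)
    (hP i).projective
  have hs : Function.Surjective f0 := fun t => by
    obtain ⟨h, hh⟩ := hd0 (LinearMap.toSpanSingleton B T t)
    refine ⟨h, (LinearMap.congr_fun hh 1).trans ?_⟩
    simp
  have hf1 : Function.Exact (f 0) f0 := fun h => by
    refine Iff.trans ?_ (hd1 h)
    constructor
    · intro hh
      refine LinearMap.ext fun b => ?_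
      refine (hf0 h b).trans ?_
      rw [show h (g0 1) = 0 from hh, smul_zero]
      rfl
    · exact fun hh => LinearMap.congr_fun hh 1
  have hf2 (i : ℕ) : Function.Exact (f (i + 1)) (f i) := hd2 i
  refine ⟨⟨P, f, f0, hP, hs, hf1, hf2, extVanish_one_self _, fun i => extVanish_one_self _⟩,
    ⟨?_, ?_⟩, ?_⟩
  · refine (injective_iff_map_eq_zero _).2 fun b hb => ?_
    refine (injective_iff_map_eq_zero _).1 hg0 _ ?_
    refine (injective_iff_map_eq_zero _).1 (hrefl 0).1 _ (LinearMap.ext fun h => ?_)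
    exact (hf0 h b).trans (LinearMap.congr_fun hb _)
  · intro φ
    obtain ⟨x, hx⟩ := (hrefl 0).2 (φ ∘ₗ f0)
    have hgx : g 0 x = 0 := by
      refine (injective_iff_map_eq_zero _).1 (hrefl 1).1 _ (LinearMap.ext fun h => ?_)
      refine (LinearMap.congr_fun hx (f 0 h)).trans ?_
      rw [LinearMap.comp_apply, hf1.apply_apply_eq_zero, map_zero]
      rfl
    obtain ⟨b, rfl⟩ := (hg1 x).1 hgx
    refine ⟨b, LinearMap.ext fun t => ?_⟩
    obtain ⟨h, rfl⟩ := hs t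
    exact (hf0 h b).symm.trans (LinearMap.congr_fun hx h)
  · intro i hi
    obtain ⟨i, rfl⟩ := Nat.exists_eq_succ_of_ne_zero hi.ne'
    refine (extVanish_iff_of_exact (N := ModuleCat.of A T) P f f0 hproj hs hf1 hf2 _ i).2 ?_
    exact exact_bidual (hrefl i) (hrefl (i + 1)) (hrefl (i + 1 + 1)) (hg2 i)

theorem IsWakamatsuTilting.of_dual
    (hgB : MemGenStar B (ModuleCat.of B B) (ModuleCat.of B T))
    (hgA : MemGenStar A (ModuleCat.of A A) (ModuleCat.of A T))
    (hA : Function.Bijective (Module.toModuleEnd B T : A →+* Module.End B T))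
    (hB : Function.Bijective (Module.toModuleEnd A T : B →+* Module.End A T))
    (heB : ∀ i, 0 < i → ExtVanish B i (ModuleCat.of B T) (ModuleCat.of B T))
    (heA : ∀ i, 0 < i → ExtVanish A i (ModuleCat.of A T) (ModuleCat.of A T)) :
    IsWakamatsuTilting B (ModuleCat.of B T) := by
  obtain ⟨P, f, f0, hP, hs, hf1, hf2, -, -⟩ := hgA
  have hproj (i : ℕ) : Module.Projective A (P i) :=
    have : Module.Projective A (ModuleCat.of A A) := inferInstanceAs (Module.Projective A A)
    (hP i).projective
  have hrefl (i : ℕ) : IsReflexive A B T (P i) :=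
    (isReflexive_self hA).of_memAdd (M := ModuleCat.of A A) (hP i)
  let e : (A →ₗ[A] T) ≃ₗ[B] T :=
    { toFun h := h 1
      map_add' _ _ := rfl
      map_smul' _ _ := rfl
      invFun t := LinearMap.toSpanSingleton A T t
      left_inv h := by ext; simp
      right_inv t := by simp }
  let X (i : ℕ) : ModuleCat.{u} B := ModuleCat.of B (↥(P i) →ₗ[A] T)
  let g (i : ℕ) : ↥(X i) →ₗ[B] ↥(X (i + 1)) := LinearMap.lcomp B T (f i)
  let f0' : ↥(P 0) →ₗ[A] T := f0
  let g0 : B →ₗ[B] ↥(X 0) := LinearMap.toSpanSingleton B (↥(P 0) →ₗ[A] T) f0'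
  have hg0 (b : B) (p : P 0) : (g0 b : ↥(P 0) →ₗ[A] T) p = b • f0' p := rfl
  refine ⟨hgB, heB, X, g, g0,
    fun i => MemAdd.dual (M := ModuleCat.of A A) (L := ModuleCat.of B T) (hP i) e,
    ?_, ?_, fun i => ?_, ?_, ?_, fun i => ?_⟩
  · refine (injective_iff_map_eq_zero _).2 fun b hb => ?_
    refine (injective_iff_map_eq_zero _).1 hB.1 _ (LinearMap.ext fun t => ?_)
    obtain ⟨p, rfl⟩ := hs t
    exact LinearMap.congr_fun (show (g0 b : ↥(P 0) →ₗ[A] T) = 0 from hb) p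
  · intro (h : ↥(P 0) →ₗ[A] T)
    constructor
    · intro hh
      have hk : LinearMap.ker f0' ≤ LinearMap.ker h := fun p hp => by
        obtain ⟨q, rfl⟩ := (hf1 p).1 hp
        exact LinearMap.congr_fun (show h ∘ₗ f 0 = 0 from hh) q
      obtain ⟨φ, hφ⟩ : ∃ φ : T →ₗ[A] T, φ ∘ₗ f0' = h :=
        ⟨(LinearMap.ker f0').liftQ h hk ∘ₗ (f0'.quotKerEquivOfSurjective hs).symm.toLinearMap, by
          ext p
          have : (f0'.quotKerEquivOfSurjective hs).symm (f0' p) = Submodule.Quotient.mk p := by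
            rw [LinearEquiv.symm_apply_eq]; rfl
          simp [this]⟩
      obtain ⟨b, rfl⟩ := hB.2 φ
      exact ⟨b, hφ⟩
    · rintro ⟨b, rfl⟩
      refine LinearMap.ext fun q => ?_
      change b • f0 (f 0 q) = 0
      rw [hf1.apply_apply_eq_zero, smul_zero]
  · exact (extVanish_iff_of_exact (N := ModuleCat.of A T) P f f0 hproj hs hf1 hf2
      (ModuleCat.of A T) i).1 (heA _ i.succ_pos)
  · intro k
    obtain ⟨p, hp⟩ := hs (k 1)
    refine ⟨LinearMap.applyₗ' B p, LinearMap.ext fun b => ?_⟩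
    change b • f0 p = _
    rw [hp]
    refine (map_smul k b 1).symm.trans ?_
    rw [smul_eq_mul, mul_one]
  · intro h
    obtain ⟨p, rfl⟩ := (hrefl 0).2 h
    constructor
    · intro hh
      have hp : f0 p = 0 := by
        rw [← one_smul B (f0' p)]
        exact LinearMap.congr_fun hh 1
      obtain ⟨q, rfl⟩ := (hf1 p).1 hp
      exact ⟨LinearMap.applyₗ' B q, rfl⟩
    · rintro ⟨k, hk⟩
      obtain ⟨q, rfl⟩ := (hrefl 1).2 k
      have : f 0 q = p := (hrefl 0).1 hk
      subst this
      refine LinearMap.ext fun b => ?_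
      change b • f0 (f 0 q) = 0
      rw [hf1.apply_apply_eq_zero, smul_zero]
  · exact exact_bidual (hrefl (i + 1 + 1)) (hrefl (i + 1)) (hrefl i) (hf2 i)

end Duality

/-- Lemma 2.3. For an `(S,R)`-bimodule `T` the following are
equivalent: (i) `T` is Wakamatsu tilting as a right `R`-module with `End(T_R) = S`;
(ii) `T` is Wakamatsu tilting as a left `S`-module with `End(_S T) = R`;
(iii) `T` is a semidualizing `(S,R)`-bimodule. -/
theorem wakamatsu_tilting_tfae
    (S R : Type u) [Ring S] [Ring R] (T : Type u) [AddCommGroup T] [Module S T]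
    [Module Rᵐᵒᵖ T] [SMulCommClass S Rᵐᵒᵖ T] :
    ((IsWakamatsuTilting Rᵐᵒᵖ (ModuleCat.of Rᵐᵒᵖ T) ∧
        Function.Bijective (Module.toModuleEnd Rᵐᵒᵖ T : S →+* Module.End Rᵐᵒᵖ T)) ↔
      (IsWakamatsuTilting S (ModuleCat.of S T) ∧
        Function.Bijective (rightEndNat S R T))) ∧
    ((IsWakamatsuTilting S (ModuleCat.of S T) ∧
        Function.Bijective (rightEndNat S R T)) ↔
      IsSemidualizing S R T) := by
  have : SMulCommClass Rᵐᵒᵖ S T := SMulCommClass.symm S Rᵐᵒᵖ T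
  have h₁ : (IsWakamatsuTilting Rᵐᵒᵖ (ModuleCat.of Rᵐᵒᵖ T) ∧
      Function.Bijective (Module.toModuleEnd Rᵐᵒᵖ T : S →+* Module.End Rᵐᵒᵖ T)) ↔
      IsSemidualizing S R T := by
    constructor
    · rintro ⟨hT, hS⟩
      obtain ⟨hg, hR, he⟩ := hT.dual hS
      exact ⟨hT.1, hg, hS, hR, hT.2.1, he⟩
    · rintro ⟨hgR, hgS, hS, hR, heR, heS⟩
      exact ⟨.of_dual hgR hgS hS hR heR heS, hS⟩
  have h₂ : (IsWakamatsuTilting S (ModuleCat.of S T) ∧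
      Function.Bijective (rightEndNat S R T)) ↔ IsSemidualizing S R T := by
    constructor
    · rintro ⟨hT, hR⟩
      obtain ⟨hg, hS, he⟩ := hT.dual (A := Rᵐᵒᵖ) hR
      exact ⟨hg, hT.1, hS, hR, he, hT.2.1⟩
    · rintro ⟨hgR, hgS, hS, hR, heR, heS⟩
      exact ⟨.of_dual hgS hgR hR hS heS heR, hR⟩
  exact ⟨h₁.trans h₂.symm, h₂⟩
end

section
/- Let S and R be associative rings with identity and let T be an (S,R)-bimodule that is Wakamatsu tilting, with projective dimension of T as a right R-module equal to n < ∞. Then Ext^j_S(T, S) = 0 for all j > n. -/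
/-!
Common definitions for formalizing the Wakamatsu tilting conjecture paper.
All rings are associative with identity; right `R`-modules are treated as
left `Rᵐᵒᵖ`-modules.
-/

open CategoryTheory

universe u

/-- `⋯ → P_1 → P_0 → M → 0` is a projective resolution of the module `M`. -/
structure IsProjRes (A : Type u) [Ring A] {M : Type u} [AddCommGroup M] [Module A M] 
    (P : ℕ → ModuleCat.{u} A) (d : ∀ i, ↥(P (i + 1)) →ₗ[A] ↥(P i)) (ε : ↥(P 0) →ₗ[A] M) : Prop where
  projective : ∀ i, Module.Projective A ↥(P i)
  surjective : Function.Surjective ε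
  exact_zero : Function.Exact (d 0) ε
  exact_succ : ∀ i, Function.Exact (d (i + 1)) (d i)

section
variable {A : Type u} [Ring A] {M : ModuleCat.{u} A} {P : ℕ → ModuleCat.{u} A}
    {d : ∀ i, ↥(P (i + 1)) →ₗ[A] ↥(P i)} {ε : ↥(P 0) →ₗ[A] M}

/-- The chain complex of modules underlying a projective resolution. -/
noncomputable def IsProjRes.complex (h : IsProjRes A P d ε) : ChainComplex (ModuleCat.{u} A) ℕ :=
  ChainComplex.of P (fun i => ModuleCat.ofHom (d i)) (fun i => by
    ext x; exact (h.exact_succ i).apply_apply_eq_zero x)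

lemma IsProjRes.complex_d (h : IsProjRes A P d ε) (i : ℕ) :
    h.complex.d (i + 1) i = ModuleCat.ofHom (d i) := 
by
  simp [IsProjRes.complex]

lemma IsProjRes.d_comp (h : IsProjRes A P d ε) : h.complex.d 1 0 ≫ ModuleCat.ofHom ε = 0 := by
  rw [h.complex_d]
  ext x; exact h.exact_zero.apply_apply_eq_zero x

/-- A projective resolution by modules as a categorical `ProjectiveResolution`. -/
noncomputable def IsProjRes.toProjectiveResolution (h : IsProjRes A P d ε) :
    ProjectiveResolution M where
  complex := h.complex
  projective i := by
    have := h.projective i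
    exact (IsProjective.iff_projective (P i)).1 this
  π := (ChainComplex.toSingle₀Equiv _ _).symm ⟨ModuleCat.ofHom ε, h.d_comp⟩
  quasiIso := ⟨fun n => by
    cases n with
    | zero =>
      rw [ChainComplex.quasiIsoAt₀_iff, ShortComplex.quasiIso_iff_of_zeros']
      · have hε : ((ChainComplex.toSingle₀Equiv h.complex M).symm ⟨ModuleCat.ofHom ε, h.d_comp⟩).f 0
            = ModuleCat.ofHom ε :=
          ChainComplex.toSingle₀Equiv_symm_apply_f_zero _ h.d_comp
        have hd : ModuleCat.ofHom (d 0) ≫ ModuleCat.ofHom ε = 0 := by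
          rw [← h.complex_d]; exact h.d_comp
        refine (ShortComplex.exact_and_epi_g_iff_of_iso (S₂ := ShortComplex.mk _ _ hd) ?_).2
          ⟨?_, (ModuleCat.epi_iff_surjective _).2 h.surjective⟩
        · exact ShortComplex.isoMk (Iso.refl _) (Iso.refl _) (Iso.refl _)
            (by simp [h.complex_d]; exact (Category.id_comp _).trans (Category.comp_id _).symm)
            (by simp [hε]; exact (Category.id_comp _).trans (Category.comp_id _).symm)
        · rw [ShortComplex.moduleCat_exact_iff]
          exact fun x hx => (h.exact_zero x).1 hx
      all_goals rfl
    | succ n =>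
      rw [quasiIsoAt_iff_exactAt']
      · rw [HomologicalComplex.exactAt_iff' _ (n + 2) (n + 1) n (by simp) (by simp),
          ShortComplex.moduleCat_exact_iff]
        intro x hx
        simp only [HomologicalComplex.shortComplexFunctor'_obj_f,
          HomologicalComplex.shortComplexFunctor'_obj_g, h.complex_d] at hx ⊢
        exact (h.exact_succ n x).1 hx
      · apply ChainComplex.exactAt_succ_single_obj⟩

/-- `Ext^(j+1)(M, Y)` vanishes iff the complex `Hom(P_•, Y)` is exact in degree `j + 1`. -/
theorem extVanish_succ_iff (h : IsProjRes A P d ε) (Y : ModuleCat.{u} A) (j : ℕ) :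
    ExtVanish A (j + 1) M Y ↔ ∀ f : P (j + 1) →ₗ[A] Y, f ∘ₗ d (j + 1) = 0 →
      ∃ g : P j →ₗ[A] Y, g ∘ₗ d j = f := by
  rw [ExtVanish, ← ModuleCat.isZero_iff_subsingleton,
    (h.toProjectiveResolution.isoExt (j + 1) Y).isZero_iff,
    ← HomologicalComplex.exactAt_iff_isZero_homology,
    HomologicalComplex.exactAt_iff' _ j (j + 1) (j + 2) (by simp) (by simp),
    ShortComplex.moduleCat_exact_iff]
  have key : ∀ k (g : P k →ₗ[A] Y), (h.toProjectiveResolution.complex.linearYonedaObj ℤ Y).d k (k+1)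
     (ModuleCat.ofHom g) = ModuleCat.ofHom (g ∘ₗ d k) := by
    intro k g
    simp
    change h.complex.d (k + 1) k ≫ _ = _
    rw [h.complex_d]; rfl
  constructor
  · intro H f hf
    obtain ⟨g, hg⟩ := H (ModuleCat.ofHom f) ((key (j + 1) f).trans (by rw [hf]; rfl))
    exact ⟨ModuleCat.Hom.hom g, congrArg ModuleCat.Hom.hom ((key j _).symm.trans hg)⟩
  · intro H x hx
    obtain ⟨g, hg⟩ := H (ModuleCat.Hom.hom x)
      (congrArg ModuleCat.Hom.hom ((key (j + 1) _).symm.trans hx))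
    exact ⟨ModuleCat.ofHom g, (key j g).trans (congrArg ModuleCat.ofHom hg)⟩

theorem ExtVanish.of_retract {j : ℕ} {X Y Z : ModuleCat.{u} A} (i : Y →ₗ[A] Z) (r : Z →ₗ[A] Y)
    (hri : r ∘ₗ i = LinearMap.id) (hZ : ExtVanish A j X Z) : ExtVanish A j X Y := by
  let F := (Ext ℤ (ModuleCat.{u} A) j).obj (Opposite.op X)
  have hF : F.map (ModuleCat.ofHom i) ≫ F.map (ModuleCat.ofHom r) = 𝟙 _ := by
    rw [← F.map_comp, ← ModuleCat.ofHom_comp, hri]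
    exact F.map_id _
  have : Function.LeftInverse (F.map (ModuleCat.ofHom r)) (F.map (ModuleCat.ofHom i)) :=
    fun x => congrArg (fun φ => ModuleCat.Hom.hom φ x) hF
  exact this.injective.subsingleton

theorem ExtVanish.pi (h : IsProjRes A P d ε) {ι : Type} {j : ℕ} {Y : ModuleCat.{u} A}
    (hY : ExtVanish A (j + 1) M Y) : ExtVanish A (j + 1) M (ModuleCat.of A (ι → Y)) := by
  rw [extVanish_succ_iff h] at hY ⊢
  intro f hf
  choose g hg using fun i => hY (LinearMap.proj i ∘ₗ f) (by rw [LinearMap.comp_assoc, hf]; simp)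
  refine ⟨LinearMap.pi g, ?_⟩
  ext x i
  exact LinearMap.congr_fun (hg i) x

/-- Dimension shifting along `0 → X → Y → Z → 0`. -/
theorem ExtVanish.of_exact (h : IsProjRes A P d ε) {j : ℕ} {X Y Z : ModuleCat.{u} A}
    (i : X →ₗ[A] Y) (p : Y →ₗ[A] Z) (hi : Function.Injective i) (hip : Function.Exact i p)
    (hp : Function.Surjective p) (hZ : ExtVanish A (j + 1) M Z)
    (hY : ExtVanish A (j + 2) M Y) : ExtVanish A (j + 2) M X := by
  rw [extVanish_succ_iff h] at hY hZ ⊢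
  have := h.projective
  intro φ hφ
  obtain ⟨ψ, hψ⟩ := hY (i ∘ₗ φ) (by rw [LinearMap.comp_assoc, hφ, LinearMap.comp_zero])
  obtain ⟨θ, hθ⟩ := hZ (p ∘ₗ ψ) (by
    rw [LinearMap.comp_assoc, hψ, ← LinearMap.comp_assoc, hip.linearMap_comp_eq_zero,
      LinearMap.zero_comp])
  obtain ⟨η, hη⟩ := Module.projective_lifting_property p θ hp
  have hd : d j ∘ₗ d (j + 1) = 0 := (h.exact_succ j).linearMap_comp_eq_zero
  have hrange : ∀ x, (ψ - η ∘ₗ d j) x ∈ LinearMap.range i := fun x => by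
    refine (hip _).1 ?_
    rw [LinearMap.sub_apply, map_sub, LinearMap.comp_apply, ← LinearMap.comp_apply p η, hη, sub_eq_zero]
    exact (LinearMap.congr_fun hθ x).symm
  let e := LinearEquiv.ofInjective i hi
  refine ⟨e.symm.toLinearMap ∘ₗ (ψ - η ∘ₗ d j).codRestrict _ hrange, ?_⟩
  ext x
  apply e.injective
  apply Subtype.ext
  have h1 := LinearMap.congr_fun hψ x
  have h2 := LinearMap.congr_fun hd x
  simp at h1 h2
  simp [h1, h2, e]
end

section
variable (S : Type u) {B T : Type u} [Ring S] [Ring B] [AddCommGroup T] [Module S T] [Module B T]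
  [SMulCommClass B S T] {X : ℕ → ModuleCat.{u} B}

/-- The `S`-module of `i`-cocycles of `Hom_B(X_•, T)`. -/
def homCocycles (T : Type u) [AddCommGroup T] [Module S T] [Module B T] [SMulCommClass B S T]
    (f : ∀ i, ↥(X (i + 1)) →ₗ[B] ↥(X i)) (i : ℕ) : Submodule S (X i →ₗ[B] T) :=
  LinearMap.ker (LinearMap.lcomp S T (f i))

/-- The differential of `Hom_B(X_•, T)`, as a map to the cocycles. -/
def homCocyclesMap (T : Type u) [AddCommGroup T] [Module S T] [Module B T] [SMulCommClass B S T]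
    (f : ∀ i, ↥(X (i + 1)) →ₗ[B] ↥(X i))
    (hf : ∀ i, Function.Exact (f (i + 1)) (f i)) (i : ℕ) :
    (X i →ₗ[B] T) →ₗ[S] homCocycles S T f (i + 1) :=
  (LinearMap.lcomp S T (f i)).codRestrict _ fun g => by
    ext x
    simp [(hf i).apply_apply_eq_zero x]

/-- If `X_{n+1} → X_n` splits onto its range, then the `n`-cocycles of `Hom_B(X_•, T)` are a
direct summand of `Hom_B(X_n, T)`. -/
theorem exists_retract_homCocycles {f : ∀ i, ↥(X (i + 1)) →ₗ[B] ↥(X i)} {n : ℕ}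
    (g : X n →ₗ[B] LinearMap.range (f n))
    (hg : g ∘ₗ f n = (f n).rangeRestrict) :
    ∃ r : (X n →ₗ[B] T) →ₗ[S] homCocycles S T f n,
      r ∘ₗ (homCocycles S T f n).subtype = LinearMap.id := by
  have hmem : ∀ h : X n →ₗ[B] T, (LinearMap.id - LinearMap.lcomp S T
      ((LinearMap.range (f n)).subtype ∘ₗ g) : (X n →ₗ[B] T) →ₗ[S] X n →ₗ[B] T) h ∈ homCocycles S T f n := fun h => by
    refine LinearMap.ext fun x => ?_
    have := LinearMap.congr_fun hg x
    simp only [LinearMap.comp_apply] at this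
    simp [this]
  refine ⟨LinearMap.codRestrict _ _ hmem,
    LinearMap.ext fun ⟨h, hh⟩ => Subtype.ext (LinearMap.ext fun x => ?_)⟩
  have : h (g x) = 0 := by
    obtain ⟨y, hy⟩ := (g x).2
    rw [← hy]
    exact LinearMap.congr_fun hh y
  simp [this]

theorem ExtVanish.hom_of_memAdd {M : ModuleCat.{u} S} {P : ℕ → ModuleCat.{u} S}
    {d : ∀ i, ↥(P (i + 1)) →ₗ[S] ↥(P i)} {ε : ↥(P 0) →ₗ[S] M} (h : IsProjRes S P d ε)
    {j : ℕ} (hT : ExtVanish S (j + 1) M (ModuleCat.of S T)) {Y : ModuleCat.{u} B}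
    (hY : MemAdd B (ModuleCat.of B B) Y) :
    ExtVanish S (j + 1) M (ModuleCat.of S (Y →ₗ[B] T)) := by
  obtain ⟨k, N, ⟨e⟩⟩ := hY
  let p : (Fin k → B) →ₗ[B] Y := LinearMap.fst B Y N ∘ₗ e.symm.toLinearMap
  let q : Y →ₗ[B] (Fin k → B) := e.toLinearMap ∘ₗ LinearMap.inl B Y N
  have hpq : p ∘ₗ q = LinearMap.id := by ext; simp [p, q]
  have : ExtVanish S (j + 1) M (ModuleCat.of S ((Fin k → B) →ₗ[B] T)) :=
    (ExtVanish.pi h hT (ι := Fin k)).of_retract (LinearEquiv.piRing B T (Fin k) S).toLinearMap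
      (LinearEquiv.piRing B T (Fin k) S).symm.toLinearMap
      (LinearMap.ext (LinearEquiv.piRing B T (Fin k) S).symm_apply_apply)
  refine this.of_retract (LinearMap.lcomp S T p) (LinearMap.lcomp S T q) ?_
  refine LinearMap.ext fun g => LinearMap.ext fun y => ?_
  have := LinearMap.congr_fun hpq y
  simp only [LinearMap.comp_apply, LinearMap.id_apply] at this
  simp [this]

theorem MemAdd.projective_s13 {Y : ModuleCat.{u} B} (hY : MemAdd B (ModuleCat.of B B) Y) :
    Module.Projective B Y := by
  obtain ⟨k, N, ⟨e⟩⟩ := hY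
  have : Module.Projective B (Fin k → B) := inferInstance
  refine Module.Projective.of_split (e.toLinearMap ∘ₗ LinearMap.inl B Y N)
    (LinearMap.fst B Y N ∘ₗ e.symm.toLinearMap) ?_
  ext
  simp

theorem homCocycles_zero_equiv {f : ∀ i, ↥(X (i + 1)) →ₗ[B] ↥(X i)} {f0 : X 0 →ₗ[B] T}
    (hf0 : Function.Surjective f0) (hf : Function.Exact (f 0) f0)
    (hend : ∀ φ : T →ₗ[B] T, ∃! s : S, ∀ t, φ t = s • t) :
    Nonempty (S ≃ₗ[S] homCocycles S T f 0) := by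
  have hmem : f0 ∈ homCocycles S T f 0 := hf.linearMap_comp_eq_zero
  refine ⟨LinearEquiv.ofBijective (LinearMap.toSpanSingleton S _ ⟨f0, hmem⟩) ⟨?_, ?_⟩⟩
  · intro s s' hs
    let φ : T →ₗ[B] T :=
      { toFun := fun t => s • t
        map_add' := smul_add s
        map_smul' := fun b t => (smul_comm b s t).symm }
    refine (hend φ).unique (fun t => rfl) fun t => ?_
    obtain ⟨x, rfl⟩ := hf0 t
    exact LinearMap.congr_fun (congrArg Subtype.val hs) x
  · rintro ⟨h, hh⟩
    have hker : LinearMap.ker f0 ≤ LinearMap.ker h := fun x hx => by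
      obtain ⟨y, rfl⟩ := (hf x).1 hx
      exact LinearMap.congr_fun hh y
    let φ : T →ₗ[B] T := (LinearMap.ker f0).liftQ h hker ∘ₗ
      (f0.quotKerEquivOfSurjective hf0).symm.toLinearMap
    obtain ⟨s, hs, -⟩ := hend φ
    refine ⟨s, Subtype.ext (LinearMap.ext fun x => ?_)⟩
    have : (f0.quotKerEquivOfSurjective hf0).symm (f0 x) = Submodule.Quotient.mk x := by
      rw [LinearEquiv.symm_apply_eq]; rfl
    refine (hs (f0 x)).symm.trans ?_
    simp [φ, this]

theorem homCocyclesMap_surjective {f : ∀ i, ↥(X (i + 1)) →ₗ[B] ↥(X i)} {f0 : X 0 →ₗ[B] T}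
    (h : IsProjRes B (M := ModuleCat.of B T) X f f0) {i : ℕ}
    (hT : ExtVanish B (i + 1) (ModuleCat.of B T) (ModuleCat.of B T)) :
    Function.Surjective (homCocyclesMap S T f h.exact_succ i) := by
  rintro ⟨g, hg⟩
  obtain ⟨k, hk⟩ := (extVanish_succ_iff h _ i).1 hT g hg
  exact ⟨k, Subtype.ext hk⟩

theorem exact_subtype_homCocyclesMap {f : ∀ i, ↥(X (i + 1)) →ₗ[B] ↥(X i)}
    (hf : ∀ i, Function.Exact (f (i + 1)) (f i)) (i : ℕ) :
    Function.Exact (homCocycles S T f i).subtype (homCocyclesMap S T f hf i) := by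
  intro g
  have : homCocyclesMap S T f hf i g = 0 ↔ g ∈ homCocycles S T f i := Subtype.ext_iff
  simp [this]

end

theorem PdLE.extVanish {A : Type u} [Ring A] {M : ModuleCat.{u} A} {n : ℕ} (h : PdLE A M n)
    (Y : ModuleCat.{u} A) : ExtVanish A (n + 1) M Y := by
  obtain ⟨P, d, ε, hP, hε, hd0, hd, hn⟩ := h
  rw [extVanish_succ_iff ⟨hP, hε, hd0, hd⟩]
  intro f _
  have := hn (n + 1) (by lia)
  exact ⟨0, LinearMap.ext fun x => by simp [Subsingleton.elim x 0]⟩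

theorem MemGenStar.exists_isProjRes {A : Type u} [Ring A] {M : ModuleCat.{u} A}
    (h : MemGenStar A (ModuleCat.of A A) M) :
    ∃ (X : ℕ → ModuleCat.{u} A) (f : ∀ i, ↥(X (i + 1)) →ₗ[A] ↥(X i)) (f0 : ↥(X 0) →ₗ[A] M),
      (∀ i, MemAdd A (ModuleCat.of A A) (X i)) ∧ IsProjRes A X f f0 := by
  obtain ⟨X, f, f0, hX, hf0, hf0', hf, -⟩ := h
  exact ⟨X, f, f0, hX, fun i => (hX i).projective_s13, hf0, hf0', hf⟩

theorem extVanish_homCocycles (S : Type u) {B T : Type u} [Ring S] [Ring B] [AddCommGroup T]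
    [Module S T] [Module B T] [SMulCommClass B S T] {X : ℕ → ModuleCat.{u} B}
    {f : ∀ i, ↥(X (i + 1)) →ₗ[B] ↥(X i)} {f0 : X 0 →ₗ[B] T}
    (hX : ∀ i, MemAdd B (ModuleCat.of B B) (X i))
    (h : IsProjRes B (M := ModuleCat.of B T) X f f0)
    (hTB : ∀ i, 0 < i → ExtVanish B i (ModuleCat.of B T) (ModuleCat.of B T))
    {M : ModuleCat.{u} S} {P : ℕ → ModuleCat.{u} S} {d : ∀ i, ↥(P (i + 1)) →ₗ[S] ↥(P i)}
    {ε : ↥(P 0) →ₗ[S] M} (hP : IsProjRes S P d ε)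
    (hM : ∀ i, 0 < i → ExtVanish S i M (ModuleCat.of S T)) {n : ℕ}
    (hpd : PdLE B (ModuleCat.of B T) n) (k i : ℕ) (hki : i + k = n) (j : ℕ) (hj : k < j) :
    ExtVanish S j M (ModuleCat.of S (homCocycles S T f i)) := by
  have hHom : ∀ i j, 0 < j → ExtVanish S j M (ModuleCat.of S (X i →ₗ[B] T)) := fun i j hj => by
    obtain ⟨j, rfl⟩ := Nat.exists_eq_add_of_lt hj
    simpa using ExtVanish.hom_of_memAdd S hP (hM _ hj) (hX i)
  induction k generalizing i j with
  | zero =>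
    obtain rfl : i = n := hki
    obtain ⟨g, hg⟩ := (extVanish_succ_iff h _ i).1
      (hpd.extVanish (ModuleCat.of B (LinearMap.range (f i)))) (f i).rangeRestrict (by
        refine LinearMap.ext fun x => Subtype.ext ?_
        exact (h.exact_succ i).apply_apply_eq_zero x)
    obtain ⟨r, hr⟩ := exists_retract_homCocycles S (T := T) g hg
    exact (hHom i j hj).of_retract _ r hr
  | succ k ih =>
    obtain ⟨j, rfl⟩ : ∃ m, j = m + 2 := ⟨j - 2, by lia⟩
    exact ExtVanish.of_exact hP (homCocycles S T f i).subtype (homCocyclesMap S T f h.exact_succ i)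
      Subtype.val_injective (exact_subtype_homCocyclesMap S h.exact_succ i)
      (homCocyclesMap_surjective S h (hTB _ i.succ_pos)) (ih (i + 1) (by lia) (j + 1) (by lia))
      (hHom i _ (by lia))

/-- part of the proof of Theorem 2.18. Let `T` be a Wakamatsu tilting
(semidualizing) `(S,R)`-bimodule with `pd(T_R) = n < ∞`. Then `Ext^j_S(T, S) = 0` for all
`j > n`. -/
theorem ext_self_vanish_of_pd_eq
    (S R : Type u) [Ring S] [Ring R] (T : Type u) [AddCommGroup T] [Module S T]
    [Module Rᵐᵒᵖ T] [SMulCommClass S Rᵐᵒᵖ T]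
    (hsd : IsSemidualizing S R T)
    (n : ℕ) (hpd : PdEq Rᵐᵒᵖ (ModuleCat.of Rᵐᵒᵖ T) n) :
    ∀ j, n < j → ExtVanish S j (ModuleCat.of S T) (ModuleCat.of S S) := by
  obtain ⟨hR, hS, hend, -, hTR, hTS⟩ := hsd
  have := SMulCommClass.symm S Rᵐᵒᵖ T
  obtain ⟨X, f, f0, hX, hres⟩ := hR.exists_isProjRes
  obtain ⟨P, d, ε, -, hP⟩ := hS.exists_isProjRes
  obtain ⟨e⟩ := homCocycles_zero_equiv S hres.surjective hres.exact_zero fun φ => by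
    obtain ⟨s, hs, hs'⟩ := hend.existsUnique φ
    exact ⟨s, fun t => (LinearMap.congr_fun hs t).symm,
      fun s' h => hs' s' (LinearMap.ext fun t => (h t).symm)⟩
  intro j hj
  exact (extVanish_homCocycles S hX hres hTR hP hTS hpd.1 n 0 (zero_add n) j hj).of_retract
    e.toLinearMap e.symm.toLinearMap (LinearMap.ext e.symm_apply_apply)
end
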